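/- arXiv:math/0303098 — 2 statements merged into one kernel-verified Lean document; each statement's English description precedes it below -/
import Mathlib

section
/- Let B be a basis of V such that Gr(B) is connected. Then: (1) V₀₀₀ is a linear subspace of V; (2) for every x∈V∖V₀ and every u∈V₀₀₀, the vector x+u lies in the Γ_B-orbit of x, so every Γ_B-orbit in V∖V₀ is a union of cosets of V₀₀₀; and (3) dim(V₀/V₀₀₀) ≤ 1. -/
open scoped BigOperators

/-- A `ZMod 2`-valued bilinear form on `V`. -/
abbrev BForm (V : Type*) [AddCommGroup V] [Module (ZMod 2) V] :=
  V →ₗ[ZMod 2] V →ₗ[ZMod 2] ZMod 2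

variable {V : Type*} [AddCommGroup V] [Module (ZMod 2) V]

/-- `g` is the transvection `τ_b : x ↦ x + Ω(x,b)·b` for some `b ∈ B`. -/
def IsTransvection (Ω : BForm V) (B : Set V) (g : V ≃ₗ[ZMod 2] V) : Prop :=
  ∃ b ∈ B, ∀ x : V, g x = x + Ω x b • b

/-- The group `Γ_B` generated by the transvections `τ_b`, `b ∈ B`. -/
def Gamma (Ω : BForm V) (B : Set V) : Subgroup (V ≃ₗ[ZMod 2] V) :=
  Subgroup.closure {g | IsTransvection Ω B g}

/-- `x` and `y` lie in the same `Γ_B`-orbit. -/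
def SameOrbit (Ω : BForm V) (B : Set V) (x y : V) : Prop :=
  ∃ g ∈ Gamma Ω B, g x = y

/-- The graph `Gr(X)` on vertex set `X`, with `b, b'` adjacent iff `Ω(b,b') = 1` or `Ω(b',b) = 1`. -/
def Gr (Ω : BForm V) (X : Set V) : SimpleGraph X :=
  SimpleGraph.fromRel fun a b => Ω a.1 b.1 = 1

/-- One basic move: `B' = φ_{c,a}(B)`, replacing `c` by `c + a`. -/
def MoveRel (Ω : BForm V) (B B' : Set V) : Prop :=
  ∃ a c, a ∈ B ∧ c ∈ B ∧ a ≠ c ∧ Ω a c = 1 ∧ B' = insert (c + a) (B \ {c})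

/-- `B` and `B'` are equivalent: related by a finite sequence of basic moves. -/
def EquivSets (Ω : BForm V) : Set V → Set V → Prop :=
  Relation.ReflTransGen (MoveRel Ω)

/-- The kernel `V₀` of the form `Ω`. -/
def V0set (Ω : BForm V) : Set V := {x | ∀ v : V, Ω x v = 0}

/-- `Δ`, the `Γ_B`-orbit containing `B` (when `Gr(B)` is connected). -/
def Delta (Ω : BForm V) (B : Set V) : Set V :=
  {x | ∃ b ∈ B, SameOrbit Ω B b x}

/-- `V₀₀₀`: vectors of `V₀` of the form `x₁ + x₂` with `x₁, x₂ ∈ Δ`. -/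
def V000set (Ω : BForm V) (B : Set V) : Set V :=
  {y | y ∈ V0set Ω ∧ ∃ x₁ ∈ Delta Ω B, ∃ x₂ ∈ Delta Ω B, y = x₁ + x₂}

/-- `U₀₀₀` for `U = span(B)`: vectors of `U₀` of the form `x₁ + x₂` with `x₁, x₂ ∈ Δ`. -/
def U000set (Ω : BForm V) (B : Set V) : Set V :=
  {y | y ∈ Submodule.span (ZMod 2) B ∧ (∀ u ∈ Submodule.span (ZMod 2) B, Ω y u = 0) ∧
    ∃ x₁ ∈ Delta Ω B, ∃ x₂ ∈ Delta Ω B, y = x₁ + x₂}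

/-- `x = x₁ + ⋯ + x_s` with all `x_i ∈ Δ` and `Ω(x_i, x_j) = 0`: a `Δ`-decomposition. -/
def HasDeltaDecomp (Ω : BForm V) (B : Set V) (x : V) (s : ℕ) : Prop :=
  1 ≤ s ∧ ∃ f : Fin s → V, (∀ i, f i ∈ Delta Ω B) ∧
    (∀ i j, i ≠ j → Ω (f i) (f j) = 0) ∧ x = ∑ i, f i

/-- `d(x)`: minimal length of a `Δ`-decomposition of `x`. -/
noncomputable def dval (Ω : BForm V) (B : Set V) (x : V) : ℕ :=
  sInf {s | HasDeltaDecomp Ω B x s}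

/-- `Q` is the quadratic form associated with `Ω` and `S` (`Q(b)=1` on `S`, polarization `Ω`). -/
def IsQuadForm (Ω : BForm V) (S : Set V) (Q : V → ZMod 2) : Prop :=
  (∀ b ∈ S, Q b = 1) ∧ ∀ u v : V, Q (u + v) = Q u + Q v + Ω u v

/-- The tree of type `D_{m,k}`: path `a₁ — ⋯ — a_m` with leaves `c₁, …, c_k` attached to `a_m`. -/
def DmkGraph (m k : ℕ) : SimpleGraph (Fin m ⊕ Fin k) :=
  SimpleGraph.fromRel fun x y =>
    match x, y with
    | Sum.inl i, Sum.inl j => i.val + 1 = j.val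
    | Sum.inl i, Sum.inr _ => i.val + 1 = m
    | _, _ => False

/-- The Dynkin tree `E₆`. -/
def E6Graph : SimpleGraph (Fin 6) :=
  SimpleGraph.fromRel fun i j => (i.val, j.val) ∈ [(0,1),(1,2),(2,3),(3,4),(2,5)]

/-- Two triangles sharing a common edge: four vertices, five edges. -/
def TwoTrianglesGraph : SimpleGraph (Fin 4) :=
  SimpleGraph.fromRel fun i j => (i.val, j.val) ∈ [(0,1),(0,2),(0,3),(1,2),(1,3)]

/-- The cycle of length `n`. -/
def CycleGraph (n : ℕ) : SimpleGraph (Fin n) :=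
  SimpleGraph.fromRel fun i j => j.val = (i.val + 1) % n

/-- Membership in the family `F`: type `D_{2,2}`, two triangles sharing an edge,
or a cycle of length at least `4`. -/
def InF {α : Type*} (G : SimpleGraph α) : Prop :=
  Nonempty (G ≃g DmkGraph 2 2) ∨ Nonempty (G ≃g TwoTrianglesGraph) ∨
    ∃ n, 4 ≤ n ∧ Nonempty (G ≃g CycleGraph n)

/-- `B` is equivalent to a set whose graph is a tree of type `D_{m,k}`. -/
def EquivToDmkTree (Ω : BForm V) (B : Set V) (m k : ℕ) : Prop :=
  ∃ B' : Set V, EquivSets Ω B B' ∧ Nonempty (Gr Ω B' ≃g DmkGraph m k)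

/-- `X` is equivalent to a set whose graph is `E₆`. -/
def EquivToE6 (Ω : BForm V) (X : Set V) : Prop :=
  ∃ X' : Set V, EquivSets Ω X X' ∧ Nonempty (Gr Ω X' ≃g E6Graph)

/-- Some subset of `B` is equivalent to a set whose graph is `E₆`. -/
def HasE6Subgraph (Ω : BForm V) (B : Set V) : Prop :=
  ∃ X ⊆ B, EquivToE6 Ω X

/-- `B` is a basis of `V` (as a set). -/
def IsBasisSet (B : Set V) : Prop :=
  LinearIndependent (ZMod 2) (Subtype.val : B → V) ∧ Submodule.span (ZMod 2) B = ⊤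

/-- `B` is equivalent to a set whose graph is a tree containing `E₆` as an induced subgraph. -/
def EquivToE6Tree (Ω : BForm V) (B : Set V) : Prop :=
  ∃ B' : Set V, EquivSets Ω B B' ∧ (Gr Ω B').IsTree ∧
    ∃ X ⊆ B', Nonempty (Gr Ω X ≃g E6Graph)

/-- `A` is a maximal complete subgraph (maximal clique) of `G`. -/
def IsMaxClique {α : Type*} (G : SimpleGraph α) (A : Set α) : Prop :=
  G.IsClique A ∧ ∀ A', G.IsClique A' → A ⊆ A' → A' = A

theorem zmod_two_eq_zero_or_one (c : ZMod 2) : c = 0 ∨ c = 1 := by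
  decide +revert

theorem BForm.symm_of_alt {Ω : BForm V} (hΩ : ∀ x : V, Ω x x = 0) (a b : V) :
    Ω a b = Ω b a := by
  have h := hΩ (a + b)
  simp only [map_add, LinearMap.add_apply, hΩ] at h
  grind

/-- A spanning set `D` closed under sums of non-orthogonal pairs and such that any two
elements have a common non-orthogonal partner in `D`. -/
structure IsCotriangular (Ω : BForm V) (D : Set V) : Prop where
  alt : ∀ x : V, Ω x x = 0
  add_mem : ∀ a ∈ D, ∀ b ∈ D, Ω a b = 1 → a + b ∈ D
  exists_common : ∀ a ∈ D, ∀ b ∈ D, ∃ w ∈ D, Ω w a = 1 ∧ Ω w b = 1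
  span_eq_top : Submodule.span (ZMod 2) D = ⊤
  nonempty : D.Nonempty

/-- The radical vectors which are sums of two elements of `D`. -/
def radicalPairs (Ω : BForm V) (D : Set V) : Set V :=
  {y | y ∈ V0set Ω ∧ ∃ x₁ ∈ D, ∃ x₂ ∈ D, y = x₁ + x₂}

theorem V0set_add {Ω : BForm V} {x y : V} (hx : x ∈ V0set Ω) (hy : y ∈ V0set Ω) :
    x + y ∈ V0set Ω := fun v => by
  simp [hx v, hy v]

namespace IsCotriangular

variable {Ω : BForm V} {D : Set V}

theorem symm (h : IsCotriangular Ω D) (a b : V) : Ω a b = Ω b a :=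
  BForm.symm_of_alt h.alt a b

theorem apply_radical (h : IsCotriangular Ω D) {x : V} (hx : x ∈ V0set Ω) (v : V) :
    Ω v x = 0 := by
  rw [h.symm, hx v]

theorem zero_mem_radicalPairs (h : IsCotriangular Ω D) : (0 : V) ∈ radicalPairs Ω D := by
  obtain ⟨d, hd⟩ := h.nonempty
  exact ⟨fun v => by simp, d, hd, d, hd, (ZModModule.add_self d).symm⟩

theorem mem_V0set (h : IsCotriangular Ω D) {x : V} (hx : ∀ v ∈ D, Ω v x = 0) :
    x ∈ V0set Ω := by
  intro v
  rw [h.symm]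
  have hle : Submodule.span (ZMod 2) D ≤ LinearMap.ker (Ω.flip x) :=
    Submodule.span_le.2 fun d hd => by simpa using hx d hd
  rw [h.span_eq_top] at hle
  simpa using hle (Submodule.mem_top (x := v))

/-- If `a` is non-orthogonal to both `v` and `w`, then one of
`v + w`, `v + a + w` lies in `D`. -/
theorem add_or_add_add_mem (h : IsCotriangular Ω D) {a v w : V} (ha : a ∈ D) (hv : v ∈ D)
    (hw : w ∈ D) (hva : Ω v a = 1) (hwa : Ω w a = 1) : v + w ∈ D ∨ v + a + w ∈ D := by
  rcases zmod_two_eq_zero_or_one (Ω v w) with hvw | hvw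
  · refine Or.inr (h.add_mem _ (h.add_mem _ hv _ ha hva) _ hw ?_)
    simp only [map_add, LinearMap.add_apply, hvw, h.symm a w, hwa]
    rfl
  · exact Or.inl (h.add_mem _ hv _ hw hvw)

theorem exists_multiset_sum (h : IsCotriangular Ω D) (x : V) :
    ∃ m : Multiset V, (∀ v ∈ m, v ∈ D) ∧ m.sum = x := by
  have hx : x ∈ Submodule.span (ZMod 2) D := h.span_eq_top ▸ Submodule.mem_top
  induction hx using Submodule.span_induction with
  | mem v hv => exact ⟨{v}, by simpa using hv, by simp⟩
  | zero => exact ⟨0, by simp, by simp⟩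
  | add v w _ _ ihv ihw =>
    obtain ⟨m, hm, rfl⟩ := ihv
    obtain ⟨m', hm', rfl⟩ := ihw
    refine ⟨m + m', fun v hv => ?_, by simp⟩
    rcases Multiset.mem_add.1 hv with hv | hv
    exacts [hm v hv, hm' v hv]
  | smul c v _ ih =>
    rcases zmod_two_eq_zero_or_one c with rfl | rfl
    · exact ⟨0, by simp, by simp⟩
    · simpa using ih

/-- A shortest expression of a vector as a sum of elements of `D`. -/
theorem exists_minimal_finset (h : IsCotriangular Ω D) (x : V) :
    ∃ S : Finset V, (∀ v ∈ S, v ∈ D) ∧ ∑ v ∈ S, v = x ∧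
      ∀ m : Multiset V, (∀ v ∈ m, v ∈ D) → m.sum = x → S.card ≤ m.card := by
  classical
  have hex : ∃ n, ∃ m : Multiset V, ((∀ v ∈ m, v ∈ D) ∧ m.sum = x) ∧ m.card = n := by
    obtain ⟨m, hm⟩ := h.exists_multiset_sum x
    exact ⟨_, m, hm, rfl⟩
  obtain ⟨m, ⟨hmD, hmx⟩, hmc⟩ := Nat.find_spec hex
  have hmin : ∀ m' : Multiset V, (∀ v ∈ m', v ∈ D) → m'.sum = x → m.card ≤ m'.card :=
    fun m' h1 h2 => hmc ▸ Nat.find_min' hex ⟨m', ⟨h1, h2⟩, rfl⟩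
  have hnd : m.Nodup := by
    rw [Multiset.nodup_iff_ne_cons_cons]
    rintro a t rfl
    have hle := hmin t (fun v hv => hmD v (by simp [hv])) (by
      rw [← hmx, Multiset.sum_cons, Multiset.sum_cons, ← add_assoc, ZModModule.add_self,
        zero_add])
    simp at hle
  refine ⟨⟨m, hnd⟩, fun v hv => hmD v hv, ?_, hmin⟩
  simpa [Finset.sum] using hmx

/-- Elements of a shortest expression are pairwise orthogonal. -/
theorem orthogonal_of_minimal (h : IsCotriangular Ω D) {S : Finset V} (hS : ∀ v ∈ S, v ∈ D)
    (hmin : ∀ m : Multiset V, (∀ v ∈ m, v ∈ D) → m.sum = ∑ v ∈ S, v → S.card ≤ m.card)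
    {a b : V} (ha : a ∈ S) (hb : b ∈ S) : Ω a b = 0 := by
  classical
  by_contra hab
  have hab1 := (zmod_two_eq_zero_or_one (Ω a b)).resolve_left hab
  have hne : a ≠ b := by
    rintro rfl
    exact hab (h.alt a)
  have hb' : b ∈ S.erase a := Finset.mem_erase.2 ⟨hne.symm, hb⟩
  have hle := hmin ((a + b) ::ₘ ((S.erase a).erase b).val) (by
    intro v hv
    rcases Multiset.mem_cons.1 hv with rfl | hv
    · exact h.add_mem a (hS a ha) b (hS b hb) hab1
    · exact hS v (Finset.mem_of_mem_erase (Finset.mem_of_mem_erase hv))) (by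
    rw [← Finset.add_sum_erase S (fun v => v) ha, ← Finset.add_sum_erase _ (fun v => v) hb',
      Multiset.sum_cons, Finset.sum_eq_multiset_sum, Multiset.map_id', add_assoc])
  have c1 := Finset.card_erase_add_one ha
  have c2 := Finset.card_erase_add_one hb'
  rw [Multiset.card_cons, Finset.card_val] at hle
  omega

/-- An element of `D` is non-orthogonal to at most two members of a shortest expression. -/
theorem eq_or_eq_of_minimal (h : IsCotriangular Ω D) {S : Finset V} (hS : ∀ v ∈ S, v ∈ D)
    (hmin : ∀ m : Multiset V, (∀ v ∈ m, v ∈ D) → m.sum = ∑ v ∈ S, v → S.card ≤ m.card)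
    {a b c z : V} (ha : a ∈ S) (hb : b ∈ S) (hc : c ∈ S) (hz : z ∈ D) (hab : a ≠ b)
    (hza : Ω z a = 1) (hzb : Ω z b = 1) (hzc : Ω z c = 1) : c = a ∨ c = b := by
  classical
  by_contra! hne
  have hb' : b ∈ S.erase a := Finset.mem_erase.2 ⟨hab.symm, hb⟩
  have hc' : c ∈ (S.erase a).erase b :=
    Finset.mem_erase.2 ⟨hne.2, Finset.mem_erase.2 ⟨hne.1, hc⟩⟩
  have hba := h.orthogonal_of_minimal hS hmin ha hb
  have hca := h.orthogonal_of_minimal hS hmin ha hc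
  have hcb := h.orthogonal_of_minimal hS hmin hb hc
  have hw : z + a + b + c ∈ D := by
    refine h.add_mem _ (h.add_mem _ (h.add_mem _ hz _ (hS a ha) hza) _ (hS b hb) ?_) _
      (hS c hc) ?_ <;>
    simp [hzb, hzc, hba, hca, hcb]
  have hle := hmin (z ::ₘ (z + a + b + c) ::ₘ (((S.erase a).erase b).erase c).val) (by
    intro v hv
    rcases Multiset.mem_cons.1 hv with rfl | hv
    · exact hz
    rcases Multiset.mem_cons.1 hv with rfl | hv
    · exact hw
    · exact hS v (Finset.mem_of_mem_erase (Finset.mem_of_mem_erase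
        (Finset.mem_of_mem_erase hv)))) (by
    rw [← Finset.add_sum_erase S (fun v => v) ha, ← Finset.add_sum_erase _ (fun v => v) hb',
      ← Finset.add_sum_erase _ (fun v => v) hc', Multiset.sum_cons, Multiset.sum_cons]
    have hzz := ZModModule.add_self z
    rw [Finset.sum_eq_multiset_sum, Multiset.map_id']
    grind)
  have c1 := Finset.card_erase_add_one ha
  have c2 := Finset.card_erase_add_one hb'
  have c3 := Finset.card_erase_add_one hc'
  rw [Multiset.card_cons, Multiset.card_cons, Finset.card_val] at hle
  omega

/-- An element of `D` non-orthogonal to one member of an expression of a radical vector is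
non-orthogonal to a second one. -/
theorem exists_ne_of_sum_radical (h : IsCotriangular Ω D) {S : Finset V}
    (hx : ∑ v ∈ S, v ∈ V0set Ω) {a z : V} (ha : a ∈ S) (hza : Ω z a = 1) :
    ∃ b ∈ S, b ≠ a ∧ Ω z b = 1 := by
  classical
  by_contra! hno
  have h0 := h.apply_radical hx z
  rw [map_sum, Finset.sum_eq_single_of_mem a ha fun b hb hba =>
    (zmod_two_eq_zero_or_one _).resolve_right (hno b hb hba), hza] at h0
  exact one_ne_zero h0

end IsCotriangular

/-- A finite orthogonal subset of `D` such that each element of `D` is non-orthogonal to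
either none or exactly two of its members. -/
structure IsFrame (Ω : BForm V) (D : Set V) (S : Finset V) : Prop where
  mem : ∀ a ∈ S, a ∈ D
  orthogonal : ∀ a ∈ S, ∀ b ∈ S, Ω a b = 0
  eq_or_eq : ∀ z ∈ D, ∀ a ∈ S, ∀ b ∈ S, ∀ c ∈ S, a ≠ b → Ω z a = 1 → Ω z b = 1 →
    Ω z c = 1 → c = a ∨ c = b
  exists_ne : ∀ z ∈ D, ∀ a ∈ S, Ω z a = 1 → ∃ b ∈ S, b ≠ a ∧ Ω z b = 1

theorem Finset.exists_mem_ne_of_four_le_card {α : Type*} {S : Finset α} (hS : 4 ≤ S.card)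
    (a b c : α) : ∃ d ∈ S, d ≠ a ∧ d ≠ b ∧ d ≠ c := by
  classical
  obtain ⟨d, hd, hn⟩ := Finset.exists_mem_notMem_of_card_lt_card
    (lt_of_le_of_lt (Finset.card_le_three (a := a) (b := b) (c := c)) hS)
  exact ⟨d, hd, by simpa using hn⟩

namespace IsFrame

variable {Ω : BForm V} {D : Set V} {S : Finset V}

theorem apply_eq_zero (hF : IsFrame Ω D S) {z a b c : V} (hz : z ∈ D) (ha : a ∈ S)
    (hb : b ∈ S) (hc : c ∈ S) (hab : a ≠ b) (hza : Ω z a = 1) (hzb : Ω z b = 1)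
    (hca : c ≠ a) (hcb : c ≠ b) : Ω z c = 0 := by
  refine (zmod_two_eq_zero_or_one _).resolve_right fun hzc => ?_
  rcases hF.eq_or_eq z hz a ha b hb c hc hab hza hzb hzc with h | h
  exacts [hca h, hcb h]

/-- Two neighbours of an element orthogonal to the frame have intersecting supports. -/
theorem supports_intersect (hF : IsFrame Ω D S) (h : IsCotriangular Ω D) {w z z' a b c d : V}
    (hw : w ∈ D) (hwS : ∀ e ∈ S, Ω w e = 0) (hz : z ∈ D) (hz' : z' ∈ D) (hzw : Ω z w = 1)
    (hzw' : Ω z' w = 1) (ha : a ∈ S) (hb : b ∈ S) (hc : c ∈ S) (hd : d ∈ S) (hab : a ≠ b)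
    (hcd : c ≠ d) (hza : Ω z a = 1) (hzb : Ω z b = 1) (hzc : Ω z' c = 1) (hzd : Ω z' d = 1) :
    c = a ∨ c = b ∨ d = a ∨ d = b := by
  by_contra! hne
  obtain ⟨hca, hcb, hda, hdb⟩ := hne
  have h1 := hF.apply_eq_zero hz ha hb hc hab hza hzb hca hcb
  have h2 := hF.apply_eq_zero hz' hc hd ha hcd hzc hzd hca.symm hda.symm
  have h3 := hF.apply_eq_zero hz' hc hd hb hcd hzc hzd hcb.symm hdb.symm
  have key : ∀ u ∈ D, Ω u a = 1 → Ω u b = 1 → Ω u c = 1 → False := fun u hu ua ub uc => by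
    rcases hF.eq_or_eq u hu a ha b hb c hc hab ua ub uc with h | h
    exacts [hca h, hcb h]
  rcases h.add_or_add_add_mem hw hz hz' hzw hzw' with hu | hu <;>
  refine key _ hu ?_ ?_ ?_ <;>
  simp [hza, hzb, hzc, h1, h2, h3, hwS a ha, hwS b hb, hwS c hc]

/-- The supports of the neighbours of an element orthogonal to the frame have a common member. -/
theorem exists_center (hF : IsFrame Ω D S) (h : IsCotriangular Ω D) (hS : 4 ≤ S.card) {w : V}
    (hw : w ∈ D) (hwS : ∀ e ∈ S, Ω w e = 0) :
    ∃ a ∈ S, ∀ v ∈ D, Ω v w = 1 → ∀ e ∈ S, Ω v e = 1 → Ω v a = 1 := by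
  have int := fun {z z' a b c d : V} => hF.supports_intersect h (z := z) (z' := z') (a := a)
    (b := b) (c := c) (d := d) hw hwS
  have hex : ∀ p ∈ S, ∃ z ∈ D, Ω z w = 1 ∧ Ω z p = 1 ∧ ∃ q ∈ S, q ≠ p ∧ Ω z q = 1 := by
    intro p hp
    obtain ⟨z, hz, hzw, hzp⟩ := h.exists_common w hw p (hF.mem p hp)
    exact ⟨z, hz, hzw, hzp, hF.exists_ne z hz p hp hzp⟩
  obtain ⟨a, b, r, ha, hb, hr, z₀, z₁, hz₀, hz₁, hab, har, hbr, h0w, h0a, h0b, h1w, h1a, h1r⟩ :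
      ∃ a b r, a ∈ S ∧ b ∈ S ∧ r ∈ S ∧ ∃ z₀ z₁, z₀ ∈ D ∧ z₁ ∈ D ∧ a ≠ b ∧ a ≠ r ∧ b ≠ r ∧
        Ω z₀ w = 1 ∧ Ω z₀ a = 1 ∧ Ω z₀ b = 1 ∧ Ω z₁ w = 1 ∧ Ω z₁ a = 1 ∧ Ω z₁ r = 1 := by
    have hne : S.Nonempty := Finset.card_pos.1 (by omega)
    obtain ⟨p, hp⟩ := hne
    obtain ⟨z₀, hz₀, h0w, h0p, q, hq, hqp, h0q⟩ := hex p hp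
    obtain ⟨r, hr, hrp, hrq, -⟩ := Finset.exists_mem_ne_of_four_le_card hS p q q
    obtain ⟨z₁, hz₁, h1w, h1r, t, ht, htr, h1t⟩ := hex r hr
    rcases int hz₀ hz₁ h0w h1w hp hq hr ht hqp.symm htr.symm h0p h0q h1r h1t with
      e | e | e | e
    · exact absurd e hrp
    · exact absurd e hrq
    · subst e
      exact ⟨t, q, r, hp, hq, hr, z₀, z₁, hz₀, hz₁, hqp.symm, htr, hrq.symm, h0w, h0p, h0q,
        h1w, h1t, h1r⟩
    · subst e
      exact ⟨t, p, r, hq, hp, hr, z₀, z₁, hz₀, hz₁, hqp, htr, hrp.symm, h0w, h0q, h0p,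
        h1w, h1t, h1r⟩
  obtain ⟨d, hd, hda, hdb, hdr⟩ := Finset.exists_mem_ne_of_four_le_card hS a b r
  obtain ⟨z₂, hz₂, h2w, h2d, t, ht, htd, h2t⟩ := hex d hd
  have hta : t = a := by
    have i1 := int hz₀ hz₂ h0w h2w ha hb hd ht hab htd.symm h0a h0b h2d h2t
    have i2 := int hz₁ hz₂ h1w h2w ha hr hd ht har htd.symm h1a h1r h2d h2t
    grind
  subst hta
  refine ⟨t, ha, fun v hv hvw e he hve => ?_⟩
  obtain ⟨e', he', hee', hve'⟩ := hF.exists_ne v hv e he hve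
  have i0 := int hz₀ hv h0w hvw ha hb he he' hab hee'.symm h0a h0b hve hve'
  have i1 := int hz₁ hv h1w hvw ha hr he he' har hee'.symm h1a h1r hve hve'
  have i2 := int hz₂ hv h2w hvw ht hd he he' htd hee'.symm h2t h2d hve hve'
  grind

/-- An element of `D` orthogonal to the frame pairs like a frame member with all elements of
`D` that are not orthogonal to the frame. -/
theorem exists_apply_eq (hF : IsFrame Ω D S) (h : IsCotriangular Ω D) (hS : 4 ≤ S.card) {w : V}
    (hw : w ∈ D) (hwS : ∀ e ∈ S, Ω w e = 0) :
    ∃ a ∈ S, ∀ v ∈ D, ∀ e ∈ S, Ω v e = 1 → Ω v w = Ω v a := by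
  obtain ⟨a, ha, hc⟩ := hF.exists_center h hS hw hwS
  refine ⟨a, ha, fun v hv e he hve => ?_⟩
  rcases zmod_two_eq_zero_or_one (Ω v w) with hvw | hvw
  · rw [hvw]
    refine ((zmod_two_eq_zero_or_one _).resolve_right fun hva => ?_).symm
    obtain ⟨b, hb, hba, hvb⟩ := hF.exists_ne v hv a ha hva
    obtain ⟨f, hf, hfa, hfb, -⟩ := Finset.exists_mem_ne_of_four_le_card hS a b b
    obtain ⟨z, hz, hzw, hzf⟩ := h.exists_common w hw f (hF.mem f hf)
    have hza := hc z hz hzw f hf hzf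
    have hvf := hF.apply_eq_zero hv ha hb hf hba.symm hva hvb hfa hfb
    have haw : Ω a w = 0 := by rw [h.symm, hwS a ha]
    have haf := hF.orthogonal a ha f hf
    have h11 : (1 : ZMod 2) + 1 = 0 := rfl
    rcases h.add_or_add_add_mem (hF.mem a ha) hv hz hva hza with hu | hu
    · have := hc _ hu (by simp [hvw, hzw]) f hf (by simp [hvf, hzf])
      simp [hva, hza, h11] at this
    · have := hc _ hu (by simp [hvw, hzw, haw]) f hf (by simp [hvf, hzf, haf])
      simp [hva, hza, h11, h.alt] at this
  · rw [hvw, hc v hv hvw e he hve]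

theorem apply_eq_zero_of_orthogonal (hF : IsFrame Ω D S) (h : IsCotriangular Ω D)
    (hS : 4 ≤ S.card) {v w : V} (hv : v ∈ D) (hw : w ∈ D) (hvS : ∀ e ∈ S, Ω v e = 0)
    (hwS : ∀ e ∈ S, Ω w e = 0) : Ω v w = 0 := by
  refine (zmod_two_eq_zero_or_one _).resolve_right fun hvw => ?_
  obtain ⟨a, ha, hav⟩ := hF.exists_apply_eq h hS hv hvS
  obtain ⟨b, hb, hbw⟩ := hF.exists_apply_eq h hS hw hwS
  obtain ⟨c, hc, hcu⟩ := hF.exists_apply_eq h hS (h.add_mem v hv w hw hvw)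
    (fun e he => by simp [hvS e he, hwS e he])
  have key : ∀ z ∈ D, ∀ e ∈ S, Ω z e = 1 → Ω z c = Ω z a + Ω z b := fun z hz e he hze => by
    rw [← hcu z hz e he hze, ← hav z hz e he hze, ← hbw z hz e he hze, map_add]
  obtain ⟨za, hza, hzaa, -⟩ := h.exists_common a (hF.mem a ha) a (hF.mem a ha)
  obtain ⟨zb, hzb, hzbb, -⟩ := h.exists_common b (hF.mem b hb) b (hF.mem b hb)
  obtain ⟨d, hd, hda, hdb, hdc⟩ := Finset.exists_mem_ne_of_four_le_card hS a b c
  obtain ⟨z, hz, hzc, hzd⟩ := h.exists_common c (hF.mem c hc) d (hF.mem d hd)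
  have ka := key za hza a ha hzaa
  have kb := key zb hzb b hb hzbb
  have kz := key z hz c hc hzc
  have hca : c ≠ a := by
    rintro rfl
    simp [hzbb] at kb
  have hcb : c ≠ b := by
    rintro rfl
    simp [hzaa] at ka
  rw [hzc, hF.apply_eq_zero hz hc hd ha hdc.symm hzc hzd hca.symm hda.symm,
    hF.apply_eq_zero hz hc hd hb hdc.symm hzc hzd hcb.symm hdb.symm] at kz
  simp at kz

theorem exists_add_mem_radicalPairs (hF : IsFrame Ω D S) (h : IsCotriangular Ω D)
    (hS : 4 ≤ S.card) {w : V} (hw : w ∈ D) (hwS : ∀ e ∈ S, Ω w e = 0) :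
    ∃ a ∈ S, w + a ∈ radicalPairs Ω D := by
  obtain ⟨a, ha, haw⟩ := hF.exists_apply_eq h hS hw hwS
  refine ⟨a, ha, h.mem_V0set fun v hv => ?_, w, hw, a, hF.mem a ha, rfl⟩
  rw [map_add]
  by_cases hvS : ∀ e ∈ S, Ω v e = 0
  · rw [hvS a ha, hF.apply_eq_zero_of_orthogonal h hS hv hw hvS hwS, add_zero]
  · push Not at hvS
    obtain ⟨e, he, hve⟩ := hvS
    rw [haw v hv e he ((zmod_two_eq_zero_or_one _).resolve_left hve)]
    exact CharTwo.add_self_eq_zero _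

/-- A sum of elements of `D` that is orthogonal to the frame lies in the span of the frame
and the radical vectors `W` that are sums of two elements of `D`. -/
theorem sum_mem_span_sup (hF : IsFrame Ω D S) (h : IsCotriangular Ω D) (hS : 4 ≤ S.card)
    {W : Submodule (ZMod 2) V} (hW : (W : Set V) = radicalPairs Ω D) (n : ℕ) :
    ∀ m : Multiset V, m.card = n → (∀ v ∈ m, v ∈ D) → (∀ e ∈ S, Ω m.sum e = 0) →
      m.sum ∈ Submodule.span (ZMod 2) (S : Set V) ⊔ W := by
  have hspan : ∀ a ∈ S, a ∈ Submodule.span (ZMod 2) (S : Set V) ⊔ W := fun a ha =>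
    Submodule.mem_sup_left (Submodule.subset_span ha)
  induction n using Nat.strong_induction_on with
  | _ n ih =>
    intro m hmn hmD hmS
    rcases Multiset.empty_or_exists_mem m with rfl | ⟨v, hv⟩
    · simp
    obtain ⟨m', rfl⟩ := Multiset.exists_cons_of_mem hv
    have hvD := hmD v hv
    have hmD' : ∀ u ∈ m', u ∈ D := fun u hu => hmD u (Multiset.mem_cons_of_mem hu)
    rw [Multiset.card_cons] at hmn
    simp only [Multiset.sum_cons, map_add, LinearMap.add_apply] at hmS ⊢
    by_cases hvS : ∀ e ∈ S, Ω v e = 0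
    · refine add_mem ?_ (ih _ (by omega) m' rfl hmD' fun e he => ?_)
      · obtain ⟨a, ha, hva⟩ := hF.exists_add_mem_radicalPairs h hS hvD hvS
        rw [← hW] at hva
        have := add_mem (Submodule.mem_sup_right (S := Submodule.span (ZMod 2) (S : Set V)) hva)
          (hspan a ha)
        rwa [add_assoc, ZModModule.add_self, add_zero] at this
      · simpa [hvS e he] using hmS e he
    · push Not at hvS
      obtain ⟨a, ha, hva⟩ := hvS
      replace hva := (zmod_two_eq_zero_or_one _).resolve_left hva
      obtain ⟨v', hv', hva'⟩ : ∃ v' ∈ m', Ω v' a = 1 := by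
        by_contra! hno
        have h0 : Ω m'.sum a = 0 := by
          rw [← LinearMap.flip_apply, map_multiset_sum]
          refine Multiset.sum_eq_zero fun c hc => ?_
          obtain ⟨u, hu, rfl⟩ := Multiset.mem_map.1 hc
          exact (zmod_two_eq_zero_or_one _).resolve_right (hno u hu)
        have := hmS a ha
        simp [hva, h0] at this
      obtain ⟨t, rfl⟩ := Multiset.exists_cons_of_mem hv'
      have hv'D := hmD' v' hv'
      have htD : ∀ u ∈ t, u ∈ D := fun u hu => hmD' u (Multiset.mem_cons_of_mem hu)
      simp only [Multiset.sum_cons, map_add, LinearMap.add_apply, Multiset.card_cons] at *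
      have hcons : ∀ u ∈ D, ∀ p ∈ u ::ₘ t, p ∈ D := by
        intro u hu p hp
        rcases Multiset.mem_cons.1 hp with rfl | hp
        exacts [hu, htD p hp]
      rcases h.add_or_add_add_mem (hF.mem a ha) hvD hv'D hva hva' with hu | hu
      · have := ih (t.card + 1) (by omega) ((v + v') ::ₘ t) (by simp) (hcons _ hu)
          (fun e he => by
            have := hmS e he
            simp only [Multiset.sum_cons, map_add, LinearMap.add_apply]
            grind)
        rwa [Multiset.sum_cons, add_assoc] at this
      · have := ih (t.card + 1) (by omega) ((v + a + v') ::ₘ t) (by simp) (hcons _ hu)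
          (fun e he => by
            have := hmS e he
            have := hF.orthogonal a ha e he
            simp only [Multiset.sum_cons, map_add, LinearMap.add_apply]
            grind)
        have := add_mem this (hspan a ha)
        have haa := ZModModule.add_self a
        convert this using 1
        rw [Multiset.sum_cons]
        grind

/-- The sum of a frame with at least four members generates the radical modulo the radical
vectors that are sums of two elements of `D`. -/
theorem mem_or_sum_add_mem (hF : IsFrame Ω D S) (h : IsCotriangular Ω D) (hS : 4 ≤ S.card)
    {W : Submodule (ZMod 2) V} (hW : (W : Set V) = radicalPairs Ω D) {y : V}
    (hy : y ∈ V0set Ω) : y ∈ W ∨ ∑ v ∈ S, v + y ∈ W := by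
  obtain ⟨m, hm, rfl⟩ := h.exists_multiset_sum y
  obtain ⟨p, hp, u, hu, hpu⟩ := Submodule.mem_sup.1
    (hF.sum_mem_span_sup h hS hW _ m rfl hm fun e _ => hy e)
  obtain ⟨f, -, rfl⟩ := Submodule.mem_span_finset.1 hp
  have hu0 : u ∈ V0set Ω := (hW ▸ hu : u ∈ radicalPairs Ω D).1
  have hconst : ∀ a ∈ S, ∀ b ∈ S, f a = f b := by
    intro a ha b hb
    by_cases hab : a = b
    · rw [hab]
    obtain ⟨z, hz, hza, hzb⟩ := h.exists_common a (hF.mem a ha) b (hF.mem b hb)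
    have h0 := h.apply_radical hy z
    rw [← hpu, map_add, h.apply_radical hu0, add_zero, map_sum,
      Finset.sum_eq_add_of_mem a b ha hb hab] at h0
    · simp only [map_smul, hza, hzb, smul_eq_mul] at h0
      grind
    · rintro c hc ⟨hca, hcb⟩
      rw [map_smul, hF.apply_eq_zero hz ha hb hc hab hza hzb hca hcb, smul_zero]
  obtain ⟨a, ha⟩ : S.Nonempty := Finset.card_pos.1 (by omega)
  have hsum : ∑ v ∈ S, f v • v = f a • ∑ v ∈ S, v := by
    rw [Finset.smul_sum]
    exact Finset.sum_congr rfl fun v hv => by rw [hconst v hv a ha]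
  rw [← hpu, hsum]
  rcases zmod_two_eq_zero_or_one (f a) with hfa | hfa
  · left
    simpa [hfa] using hu
  · right
    rw [hfa, one_smul, ← add_assoc, ZModModule.add_self, zero_add]
    exact hu

end IsFrame

namespace IsCotriangular

variable {Ω : BForm V} {D : Set V}

theorem orthogonal_of_notMem (h : IsCotriangular Ω D) {x a b c : V} (hx : x ∈ V0set Ω)
    (hxn : x ∉ radicalPairs Ω D) (ha : a ∈ D) (hb : b ∈ D) (hc : c ∈ D)
    (hxe : x = a + b + c) : Ω a b = 0 :=
  (zmod_two_eq_zero_or_one _).resolve_right fun hab =>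
    hxn ⟨hx, a + b, h.add_mem a ha b hb hab, c, hc, hxe⟩

theorem triple_add_mem_of_apply_eq_one (h : IsCotriangular Ω D) {x y a b c b' c' : V}
    (hx : x ∈ V0set Ω) (hy : y ∈ V0set Ω) (hb : b ∈ D) (hc : c ∈ D) (hb' : b' ∈ D)
    (hc' : c' ∈ D) (hab : Ω a b = 0) (hac' : Ω a c' = 0) (hxe : x = a + b + c)
    (hye : y = a + b' + c') (hbb : Ω b b' = 1) : x + y ∈ radicalPairs Ω D := by
  have h1 := hx c'
  have h2 := h.apply_radical hy b
  rw [hxe] at h1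
  rw [hye] at h2
  simp only [map_add, LinearMap.add_apply, h.symm b a] at h1 h2
  have hcc : Ω c c' = 1 := by grind
  refine ⟨V0set_add hx hy, b + b', h.add_mem b hb b' hb' hbb, c + c',
    h.add_mem c hc c' hc' hcc, ?_⟩
  have haa := ZModModule.add_self a
  grind

theorem triple_add_mem_of_common (h : IsCotriangular Ω D) {x y a b c b' c' v : V}
    (hx : x ∈ V0set Ω) (hy : y ∈ V0set Ω) (hb : b ∈ D) (hc : c ∈ D)
    (hb' : b' ∈ D) (hc' : c' ∈ D) (hv : v ∈ D) (hab : Ω a b = 0) (hac' : Ω a c' = 0)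
    (hxe : x = a + b + c) (hye : y = a + b' + c')
    (hva : Ω v a = 0) (hvb : Ω v b = 1) (hvb' : Ω v b' = 1) : x + y ∈ radicalPairs Ω D := by
  rcases zmod_two_eq_zero_or_one (Ω b b') with hbb | hbb
  · have h1 := h.apply_radical hy v
    rw [hye] at h1
    simp only [map_add] at h1
    have hvc' : Ω v c' = 1 := by grind
    refine h.triple_add_mem_of_apply_eq_one hx hy hb hc (h.add_mem v hv b' hb' hvb')
      (h.add_mem v hv c' hc' hvc') hab (b' := v + b') (c' := v + c') ?_ hxe ?_ ?_
    · rw [map_add, h.symm a v, hva, hac', add_zero]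
    · have hvv := ZModModule.add_self v
      grind
    · rw [map_add, h.symm b v, hvb, hbb, add_zero]
  · exact h.triple_add_mem_of_apply_eq_one hx hy hb hc hb' hc' hab hac' hxe hye hbb

theorem triple_add_mem (h : IsCotriangular Ω D) {x y a b c b' c' : V}
    (hx : x ∈ V0set Ω) (hy : y ∈ V0set Ω) (hxn : x ∉ radicalPairs Ω D)
    (hyn : y ∉ radicalPairs Ω D) (ha : a ∈ D) (hb : b ∈ D) (hc : c ∈ D)
    (hb' : b' ∈ D) (hc' : c' ∈ D) (hxe : x = a + b + c) (hye : y = a + b' + c') :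
    x + y ∈ radicalPairs Ω D := by
  have hxe' : x = a + c + b := by rw [hxe, add_right_comm]
  have hye' : y = a + c' + b' := by rw [hye, add_right_comm]
  have hab := h.orthogonal_of_notMem hx hxn ha hb hc hxe
  have hac := h.orthogonal_of_notMem hx hxn ha hc hb hxe'
  have hab' := h.orthogonal_of_notMem hy hyn ha hb' hc' hye
  have hac' := h.orthogonal_of_notMem hy hyn ha hc' hb' hye'
  obtain ⟨v, hv, hvb, hvc'⟩ := h.exists_common b hb c' hc'
  obtain ⟨w, hw, hwc, hwb'⟩ := h.exists_common c hc b' hb'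
  rcases zmod_two_eq_zero_or_one (Ω v a) with hva | hva
  · exact h.triple_add_mem_of_common hx hy hb hc hc' hb' hv hab hab' hxe hye' hva hvb hvc'
  rcases zmod_two_eq_zero_or_one (Ω w a) with hwa | hwa
  · exact h.triple_add_mem_of_common hx hy hc hb hb' hc' hw hac hac' hxe' hye hwa hwc hwb'
  have h1 := h.apply_radical hx w
  have h2 := h.apply_radical hy v
  rw [hxe] at h1
  rw [hye] at h2
  simp only [map_add] at h1 h2
  have haa := h.alt a
  rcases h.add_or_add_add_mem ha hv hw hva hwa with hu | hu <;>
  refine h.triple_add_mem_of_common hx hy hb hc hb' hc' hu hab hac' hxe hye ?_ ?_ ?_ <;>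
  simp only [map_add, LinearMap.add_apply] <;>
  grind

theorem exists_triple_or_frame (h : IsCotriangular Ω D) {x : V} (hx : x ∈ V0set Ω)
    (hxn : x ∉ radicalPairs Ω D) :
    (∃ a ∈ D, ∃ b ∈ D, ∃ c ∈ D, x = a + b + c) ∨
      ∃ S : Finset V, IsFrame Ω D S ∧ 4 ≤ S.card ∧ ∑ v ∈ S, v = x := by
  classical
  obtain ⟨S, hS, rfl, hmin⟩ := h.exists_minimal_finset x
  by_cases h4 : 4 ≤ S.card
  · exact Or.inr ⟨S, ⟨hS, fun a ha b hb => h.orthogonal_of_minimal hS hmin ha hb,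
      fun z hz a ha b hb c hc => h.eq_or_eq_of_minimal hS hmin ha hb hc hz,
      fun z _ a ha => h.exists_ne_of_sum_radical hx ha⟩, h4, rfl⟩
  left
  have hcases : S.card = 0 ∨ S.card = 1 ∨ S.card = 2 ∨ S.card = 3 := by omega
  rcases hcases with h0 | h1 | h2 | h3
  · rw [Finset.card_eq_zero] at h0
    subst h0
    exact absurd h.zero_mem_radicalPairs (by simpa using hxn)
  · obtain ⟨a, rfl⟩ := Finset.card_eq_one.1 h1
    have ha := hS a (by simp)
    obtain ⟨w, -, hwa, -⟩ := h.exists_common a ha a ha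
    have := h.apply_radical hx w
    simp [hwa] at this
  · obtain ⟨a, b, hab, rfl⟩ := Finset.card_eq_two.1 h2
    exact absurd ⟨hx, a, hS a (by simp), b, hS b (by simp), Finset.sum_pair hab⟩ hxn
  · obtain ⟨a, b, c, hab, hac, hbc, rfl⟩ := Finset.card_eq_three.1 h3
    refine ⟨a, hS a (by simp), b, hS b (by simp), c, hS c (by simp), ?_⟩
    rw [Finset.sum_insert (by simp [hab, hac]), Finset.sum_pair hbc, add_assoc]

theorem add_mem_radicalPairs (h : IsCotriangular Ω D)
    {W : Submodule (ZMod 2) V} (hW : (W : Set V) = radicalPairs Ω D)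
    (hmove : ∀ a ∈ D, ∀ a' ∈ D, ∀ b' ∈ D, ∀ c' ∈ D, a' + b' + c' ∈ V0set Ω →
      ∃ b ∈ D, ∃ c ∈ D, a' + b' + c' = a + b + c)
    {x y : V} (hx : x ∈ V0set Ω) (hy : y ∈ V0set Ω) (hxn : x ∉ radicalPairs Ω D)
    (hyn : y ∉ radicalPairs Ω D) : x + y ∈ radicalPairs Ω D := by
  rcases h.exists_triple_or_frame hx hxn with ⟨a, ha, b, hb, c, hc, hxe⟩ | ⟨S, hF, hS, rfl⟩
  · rcases h.exists_triple_or_frame hy hyn with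
      ⟨a', ha', b', hb', c', hc', hye⟩ | ⟨S, hF, hS, rfl⟩
    · obtain ⟨b'', hb'', c'', hc'', he⟩ := hmove a ha a' ha' b' hb' c' hc' (hye ▸ hy)
      exact h.triple_add_mem hx hy hxn hyn ha hb hc hb'' hc'' hxe (hye.trans he)
    · rw [← hW] at hxn ⊢
      rw [add_comm]
      exact (hF.mem_or_sum_add_mem h hS hW hx).resolve_left hxn
  · rw [← hW] at hyn ⊢
    exact (hF.mem_or_sum_add_mem h hS hW hy).resolve_left hyn

end IsCotriangular

section Orbits

variable {Ω : BForm V} {B : Set V}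

/-- The transvection `x ↦ x + Ω(x,a)·a` as a linear automorphism. -/
def transvectionEquiv (Ω : BForm V) (hΩ : ∀ x : V, Ω x x = 0) (a : V) : V ≃ₗ[ZMod 2] V :=
  LinearEquiv.ofInvolutive (LinearMap.id + (Ω.flip a).smulRight a) fun x => by
    have := ZModModule.add_self (Ω x a • a)
    simp [hΩ, add_assoc, this]

theorem transvectionEquiv_apply (hΩ : ∀ x : V, Ω x x = 0) (a x : V) :
    transvectionEquiv Ω hΩ a x = x + Ω x a • a := rfl

theorem Gamma_apply_apply (hΩ : ∀ x : V, Ω x x = 0) {g : V ≃ₗ[ZMod 2] V}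
    (hg : g ∈ Gamma Ω B) (x y : V) : Ω (g x) (g y) = Ω x y := by
  induction hg using Subgroup.closure_induction generalizing x y with
  | mem g hg =>
    obtain ⟨b, -, hb⟩ := hg
    have hs := BForm.symm_of_alt hΩ b y
    simp only [hb, map_add, LinearMap.add_apply, map_smul, LinearMap.smul_apply, hΩ,
      smul_eq_mul, hs]
    grind
  | one => rfl
  | mul g g' _ _ ih ih' => rw [LinearEquiv.mul_apply, LinearEquiv.mul_apply, ih, ih']
  | inv g _ ih =>
    rw [← ih, ← LinearEquiv.mul_apply, ← LinearEquiv.mul_apply, mul_inv_cancel]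
    rfl

theorem Gamma_apply_of_mem_V0set {g : V ≃ₗ[ZMod 2] V} (hg : g ∈ Gamma Ω B) {x : V}
    (hx : x ∈ V0set Ω) : g x = x := by
  induction hg using Subgroup.closure_induction with
  | mem g hg =>
    obtain ⟨b, -, hb⟩ := hg
    rw [hb, hx b, zero_smul, add_zero]
  | one => rfl
  | mul g g' _ _ ih ih' => rw [LinearEquiv.mul_apply, ih', ih]
  | inv g _ ih =>
    rw [← ih, ← LinearEquiv.mul_apply, inv_mul_cancel, ih]
    rfl

theorem SameOrbit.refl (x : V) : SameOrbit Ω B x x := ⟨1, one_mem _, rfl⟩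

theorem SameOrbit.symm {x y : V} (h : SameOrbit Ω B x y) : SameOrbit Ω B y x := by
  obtain ⟨g, hg, rfl⟩ := h
  exact ⟨g⁻¹, inv_mem hg, by rw [← LinearEquiv.mul_apply, inv_mul_cancel]; rfl⟩

theorem SameOrbit.trans {x y z : V} (h : SameOrbit Ω B x y) (h' : SameOrbit Ω B y z) :
    SameOrbit Ω B x z := by
  obtain ⟨g, hg, rfl⟩ := h
  obtain ⟨g', hg', rfl⟩ := h'
  exact ⟨g' * g, mul_mem hg' hg, rfl⟩

theorem Delta_apply_mem {g : V ≃ₗ[ZMod 2] V} (hg : g ∈ Gamma Ω B) {x : V}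
    (hx : x ∈ Delta Ω B) : g x ∈ Delta Ω B := by
  obtain ⟨b, hb, hbx⟩ := hx
  exact ⟨b, hb, hbx.trans ⟨g, hg, rfl⟩⟩

theorem subset_Delta : B ⊆ Delta Ω B := fun b hb => ⟨b, hb, SameOrbit.refl b⟩

theorem transvectionEquiv_mem_Gamma (hΩ : ∀ x : V, Ω x x = 0) {a : V} (ha : a ∈ Delta Ω B) :
    transvectionEquiv Ω hΩ a ∈ Gamma Ω B := by
  obtain ⟨b, hb, g, hg, rfl⟩ := ha
  have hbG : transvectionEquiv Ω hΩ b ∈ Gamma Ω B :=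
    Subgroup.subset_closure ⟨b, hb, fun _ => rfl⟩
  have he : transvectionEquiv Ω hΩ (g b) = g * transvectionEquiv Ω hΩ b * g⁻¹ := by
    ext x
    obtain ⟨y, rfl⟩ := g.surjective x
    have hy : g⁻¹ (g y) = y := g.symm_apply_apply y
    simp only [LinearEquiv.mul_apply, hy, transvectionEquiv_apply, map_add, map_smul,
      Gamma_apply_apply hΩ hg]
  rw [he]
  exact mul_mem (mul_mem hg hbG) (inv_mem hg)

theorem sameOrbit_add (hΩ : ∀ x : V, Ω x x = 0) {a x : V} (ha : a ∈ Delta Ω B)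
    (hxa : Ω x a = 1) : SameOrbit Ω B x (x + a) :=
  ⟨_, transvectionEquiv_mem_Gamma hΩ ha, by rw [transvectionEquiv_apply, hxa, one_smul]⟩

theorem Delta_add_mem (hΩ : ∀ x : V, Ω x x = 0) {a b : V} (ha : a ∈ Delta Ω B)
    (hb : b ∈ Delta Ω B) (hab : Ω a b = 1) : a + b ∈ Delta Ω B := by
  obtain ⟨g, hg, hgab⟩ := sameOrbit_add hΩ hb hab
  exact hgab ▸ Delta_apply_mem hg ha

theorem Gr_adj_apply (hΩ : ∀ x : V, Ω x x = 0) {a b : B} (hab : (Gr Ω B).Adj a b) :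
    Ω (a : V) b = 1 := by
  rw [Gr, SimpleGraph.fromRel_adj] at hab
  rcases hab.2 with h | h
  · exact h
  · rw [BForm.symm_of_alt hΩ, h]

theorem sameOrbit_of_connected (hΩ : ∀ x : V, Ω x x = 0) (hconn : (Gr Ω B).Connected)
    (a b : B) : SameOrbit Ω B (a : V) b := by
  obtain ⟨p⟩ := hconn.preconnected a b
  induction p with
  | nil => exact SameOrbit.refl _
  | @cons a c b hac _ ih =>
    refine SameOrbit.trans ?_ ih
    have h1 := Gr_adj_apply hΩ hac
    have h2 := sameOrbit_add hΩ (subset_Delta (Ω := Ω) c.2) h1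
    have h3 := sameOrbit_add hΩ (subset_Delta (Ω := Ω) a.2)
      ((BForm.symm_of_alt hΩ _ _).trans h1)
    rw [add_comm] at h3
    exact h2.trans h3.symm

theorem Delta_sameOrbit (hΩ : ∀ x : V, Ω x x = 0) (hconn : (Gr Ω B).Connected) {x y : V}
    (hx : x ∈ Delta Ω B) (hy : y ∈ Delta Ω B) : SameOrbit Ω B x y := by
  obtain ⟨b, hb, hbx⟩ := hx
  obtain ⟨c, hc, hcy⟩ := hy
  exact hbx.symm.trans ((sameOrbit_of_connected hΩ hconn ⟨b, hb⟩ ⟨c, hc⟩).trans hcy)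

/-- Having a common non-orthogonal partner with `z` propagates along non-orthogonal pairs. -/
theorem exists_common_of_apply_eq_one (hΩ : ∀ x : V, Ω x x = 0) {z a b : V}
    (ha : a ∈ Delta Ω B) (hab : Ω a b = 1)
    (h : ∃ w ∈ Delta Ω B, Ω w z = 1 ∧ Ω w a = 1) :
    ∃ w ∈ Delta Ω B, Ω w z = 1 ∧ Ω w b = 1 := by
  obtain ⟨w, hw, hwz, hwa⟩ := h
  rcases zmod_two_eq_zero_or_one (Ω w b) with hwb | hwb
  · rcases zmod_two_eq_zero_or_one (Ω a z) with haz | haz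
    · exact ⟨w + a, Delta_add_mem hΩ hw ha hwa, by simp [hwz, haz], by simp [hwb, hab]⟩
    · exact ⟨a, ha, haz, hab⟩
  · exact ⟨w, hw, hwz, hwb⟩

theorem Delta_exists_common (hΩ : ∀ x : V, Ω x x = 0) (hconn : (Gr Ω B).Connected)
    (hnt : B.Nontrivial) {z x : V} (hz : z ∈ Delta Ω B) (hx : x ∈ Delta Ω B) :
    ∃ w ∈ Delta Ω B, Ω w z = 1 ∧ Ω w x = 1 := by
  have hstart : ∃ w ∈ Delta Ω B, Ω w z = 1 ∧ Ω w z = 1 := by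
    obtain ⟨b, hb, g, hg, rfl⟩ := hz
    have : Nontrivial B := Set.nontrivial_coe_sort.2 hnt
    obtain ⟨c, hc⟩ := hconn.preconnected.exists_adj_of_nontrivial ⟨b, hb⟩
    have h1 : Ω (g c) (g b) = 1 := by
      rw [Gamma_apply_apply hΩ hg]
      exact Gr_adj_apply hΩ hc.symm
    exact ⟨g c, Delta_apply_mem hg (subset_Delta c.2), h1, h1⟩
  obtain ⟨g, hg, rfl⟩ := Delta_sameOrbit hΩ hconn hz hx
  suffices h : ∀ y ∈ Delta Ω B, (∃ w ∈ Delta Ω B, Ω w z = 1 ∧ Ω w y = 1) ↔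
      ∃ w ∈ Delta Ω B, Ω w z = 1 ∧ Ω w (g y) = 1 from (h z hz).1 hstart
  clear hx hstart
  induction hg using Subgroup.closure_induction with
  | mem g hg =>
    intro y hy
    have hgy := Delta_apply_mem (Subgroup.subset_closure hg) hy
    obtain ⟨b, -, hb⟩ := hg
    rcases zmod_two_eq_zero_or_one (Ω y b) with hyb | hyb
    · rw [hb, hyb, zero_smul, add_zero]
    · have h1 : Ω y (g y) = 1 := by rw [hb, hyb, one_smul, map_add, hΩ, hyb, zero_add]
      exact ⟨exists_common_of_apply_eq_one hΩ hy h1, exists_common_of_apply_eq_one hΩ hgy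
        ((BForm.symm_of_alt hΩ _ _).trans h1)⟩
  | one => exact fun y _ => Iff.rfl
  | mul g g' _ hg' ih ih' =>
    exact fun y hy => (ih' y hy).trans (ih (g' y) (Delta_apply_mem hg' hy))
  | inv g hg ih =>
    intro y hy
    have hgy : g (g⁻¹ y) = y := g.apply_symm_apply y
    have := ih (g⁻¹ y) (Delta_apply_mem (inv_mem hg) hy)
    rw [hgy] at this
    exact this.symm

theorem Delta_isCotriangular (hΩ : ∀ x : V, Ω x x = 0)
    (hspan : Submodule.span (ZMod 2) B = ⊤) (hconn : (Gr Ω B).Connected)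
    (hnt : B.Nontrivial) : IsCotriangular Ω (Delta Ω B) where
  alt := hΩ
  add_mem _ ha _ hb := Delta_add_mem hΩ ha hb
  exists_common _ ha _ hb := Delta_exists_common hΩ hconn hnt ha hb
  span_eq_top := top_le_iff.1 (hspan ▸ Submodule.span_mono subset_Delta)
  nonempty := hnt.nonempty.mono subset_Delta

theorem Delta_add_mem_of_mem_V000set (hΩ : ∀ x : V, Ω x x = 0) (hconn : (Gr Ω B).Connected)
    {u x : V} (hu : u ∈ V000set Ω B) (hx : x ∈ Delta Ω B) : x + u ∈ Delta Ω B := by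
  obtain ⟨hu0, x₁, hx₁, x₂, hx₂, hue⟩ := hu
  obtain ⟨g, hg, rfl⟩ := Delta_sameOrbit hΩ hconn hx₁ hx
  have he : x₂ = x₁ + u := by
    rw [hue, ← add_assoc, ZModModule.add_self, zero_add]
  rw [he] at hx₂
  have := Delta_apply_mem hg hx₂
  rwa [map_add, Gamma_apply_of_mem_V0set hg hu0] at this

/-- The vectors `V₀₀₀` as a linear subspace. -/
def V000submodule (hΩ : ∀ x : V, Ω x x = 0) (hconn : (Gr Ω B).Connected) :
    Submodule (ZMod 2) V :=
  AddSubgroup.toZModSubmodule 2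
    { carrier := V000set Ω B
      zero_mem' := by
        obtain ⟨b⟩ := hconn.nonempty
        exact ⟨fun v => by simp, b, subset_Delta b.2, b, subset_Delta b.2,
          (ZModModule.add_self _).symm⟩
      add_mem' := by
        rintro u v hu ⟨hv0, x₁, hx₁, x₂, hx₂, rfl⟩
        refine ⟨V0set_add hu.1 hv0, x₁ + u, Delta_add_mem_of_mem_V000set hΩ hconn hu hx₁, x₂,
          hx₂, ?_⟩
        abel
      neg_mem' := fun {u} hu => by rwa [ZModModule.neg_eq_self] }

theorem sameOrbit_add_of_mem_V000set (hΩ : ∀ x : V, Ω x x = 0)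
    (hspan : Submodule.span (ZMod 2) B = ⊤) (hconn : (Gr Ω B).Connected) {x u : V}
    (hx : x ∉ V0set Ω) (hu : u ∈ V000set Ω B) : SameOrbit Ω B x (x + u) := by
  obtain ⟨b, hb, hxb⟩ : ∃ b ∈ B, Ω x b = 1 := by
    by_contra! hno
    have hle : Submodule.span (ZMod 2) B ≤ LinearMap.ker (Ω x) :=
      Submodule.span_le.2 fun b hb => (zmod_two_eq_zero_or_one _).resolve_right (hno b hb)
    rw [hspan] at hle
    exact hx fun v => hle Submodule.mem_top
  have hbD : b ∈ Delta Ω B := subset_Delta hb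
  have hux : ∀ v, Ω v u = 0 := fun v => by rw [BForm.symm_of_alt hΩ, hu.1 v]
  have h1 := sameOrbit_add hΩ hbD hxb
  have h2 := sameOrbit_add (x := x + b) hΩ (Delta_add_mem_of_mem_V000set hΩ hconn hu hbD)
    (by simp [hxb, hux, hΩ])
  have hbb := ZModModule.add_self b
  have he : x + b + (b + u) = x + u := by grind
  rw [he] at h2
  exact h1.trans h2

theorem add_mem_V000set (hΩ : ∀ x : V, Ω x x = 0) (hspan : Submodule.span (ZMod 2) B = ⊤)
    (hconn : (Gr Ω B).Connected) {x y : V} (hx : x ∈ V0set Ω) (hy : y ∈ V0set Ω)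
    (hxn : x ∉ V000set Ω B) (hyn : y ∉ V000set Ω B) : x + y ∈ V000set Ω B := by
  rcases B.subsingleton_or_nontrivial with hsub | hnt
  · obtain ⟨b⟩ := hconn.nonempty
    have h0 : (0 : V) ∈ V000set Ω B := (V000submodule hΩ hconn).zero_mem
    rw [hsub.eq_singleton_of_mem b.2] at hspan
    have hval : ∀ v : V, v ∉ V000set Ω B → v = b := by
      intro v hv
      obtain ⟨c, rfl⟩ := Submodule.mem_span_singleton.1
        (hspan ▸ Submodule.mem_top : v ∈ Submodule.span (ZMod 2) {(b : V)})
      rcases zmod_two_eq_zero_or_one c with rfl | rfl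
      · exact absurd h0 (by simpa using hv)
      · exact one_smul _ _
    rw [hval x hxn, hval y hyn, ZModModule.add_self]
    exact h0
  · refine (Delta_isCotriangular hΩ hspan hconn hnt).add_mem_radicalPairs
      (W := V000submodule hΩ hconn) rfl ?_ hx hy hxn hyn
    intro a ha a' ha' b' hb' c' hc' h0
    obtain ⟨g, hg, rfl⟩ := Delta_sameOrbit hΩ hconn ha' ha
    refine ⟨g b', Delta_apply_mem hg hb', g c', Delta_apply_mem hg hc', ?_⟩
    rw [← map_add, ← map_add, Gamma_apply_of_mem_V0set hg h0]

end Orbits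

/-- For a basis `B` with `Gr(B)` connected: `V₀₀₀` is a linear subspace;
adding an element of `V₀₀₀` does not change the `Γ_B`-orbit of any `x ∉ V₀` (so orbits in
`V ∖ V₀` are unions of `V₀₀₀`-cosets); and `dim(V₀/V₀₀₀) ≤ 1` (any two elements of
`V₀ ∖ V₀₀₀` differ by an element of `V₀₀₀`). -/
theorem stmt_4 {V : Type*} [AddCommGroup V] [Module (ZMod 2) V]
    [FiniteDimensional (ZMod 2) V]
    (Ω : BForm V) (hΩ : ∀ x : V, Ω x x = 0)
    (B : Set V) (hB : IsBasisSet B) (hconn : (Gr Ω B).Connected) :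
    (∃ W : Submodule (ZMod 2) V, (W : Set V) = V000set Ω B) ∧
    (∀ x : V, x ∉ V0set Ω → ∀ u ∈ V000set Ω B, SameOrbit Ω B x (x + u)) ∧
    (∀ x ∈ V0set Ω, ∀ y ∈ V0set Ω,
      x ∉ V000set Ω B → y ∉ V000set Ω B → x + y ∈ V000set Ω B) := by
  exact ⟨⟨V000submodule hΩ hconn, rfl⟩,
    fun x hx u hu => sameOrbit_add_of_mem_V000set hΩ hB.2 hconn hx hu,
    fun x hx y hy hxn hyn => add_mem_V000set hΩ hB.2 hconn hx hy hxn hyn⟩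
end

section
/- Let B be a basis of V with Gr(B) connected which is equivalent to a basis whose graph is a tree containing E₆ as an induced subgraph. Then there exists a subset X⊆B inducing a subgraph of Gr(B) isomorphic to a member of the family F such that span(X)∩V₀₀₀ = {0}. (Hence the conditions of the preceding theorem characterize the bases equivalent to trees of type D_{m,k}.) -/
open scoped BigOperators

variable {V : Type*} [AddCommGroup V] [Module (ZMod 2) V]

/-- The symmetric zero-diagonal `4 × 4` matrix over `𝔽₂` with the given entries has zero Pfaffian
and no zero row: it is the adjacency matrix of a claw, of two triangles sharing an edge or of a
4-cycle. -/
def IsD4Matrix (e₀₁ e₀₂ e₀₃ e₁₂ e₁₃ e₂₃ : ZMod 2) : Prop :=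
  e₀₁ * e₂₃ + e₀₂ * e₁₃ + e₀₃ * e₁₂ = 0 ∧
    (e₀₁ = 1 ∨ e₀₂ = 1 ∨ e₀₃ = 1) ∧ (e₀₁ = 1 ∨ e₁₂ = 1 ∨ e₁₃ = 1) ∧
    (e₀₂ = 1 ∨ e₁₂ = 1 ∨ e₂₃ = 1) ∧ (e₀₃ = 1 ∨ e₁₃ = 1 ∨ e₂₃ = 1)

instance (e₀₁ e₀₂ e₀₃ e₁₂ e₁₃ e₂₃ : ZMod 2) : Decidable (IsD4Matrix e₀₁ e₀₂ e₀₃ e₁₂ e₁₃ e₂₃) := by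
  unfold IsD4Matrix
  infer_instance

/-- The vectors `p, q, r, s` are linearly independent modulo the kernel of `Ω`. -/
def IndepModKer (Ω : BForm V) (p q r s : V) : Prop :=
  ∀ α β γ δ : ZMod 2, Ω (α • p + β • q + γ • r + δ • s) = 0 → α = 0 ∧ β = 0 ∧ γ = 0 ∧ δ = 0

/-- `p, q, r, s` span a subspace meeting the kernel of `Ω` trivially, and their graph is a claw,
two triangles sharing an edge or a 4-cycle. -/
structure IsD4Quad (Ω : BForm V) (p q r s : V) : Prop where
  matrix : IsD4Matrix (Ω p q) (Ω p r) (Ω p s) (Ω q r) (Ω q s) (Ω r s)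
  indep : IndepModKer Ω p q r s

/-- `B` contains a quadruple satisfying `IsD4Quad`. -/
def HasD4Quad (Ω : BForm V) (B : Set V) : Prop :=
  ∃ p ∈ B, ∃ q ∈ B, ∃ r ∈ B, ∃ s ∈ B, IsD4Quad Ω p q r s

lemma zmod_two_eq (x : ZMod 2) : x = 0 ∨ x = 1 := by
  revert x; decide

lemma form_comm {Ω : BForm V} (hΩ : ∀ x, Ω x x = 0) (x y : V) : Ω x y = Ω y x := by
  have h := hΩ (x + y)
  simp only [map_add, LinearMap.add_apply, hΩ, zero_add, add_zero] at h
  generalize Ω x y = u at *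
  generalize Ω y x = v at *
  revert u v; decide

namespace IndepModKer

variable {Ω : BForm V} {p q r s : V}

lemma swap (h : IndepModKer Ω p q r s) : IndepModKer Ω q p r s := by
  intro α β γ δ hz
  have := h β α γ δ (by rw [← hz]; congr 1; abel)
  tauto

lemma rotate (h : IndepModKer Ω p q r s) : IndepModKer Ω q r s p := by
  intro α β γ δ hz
  have := h δ α β γ (by rw [← hz]; congr 1; abel)
  tauto

lemma ne (h : IndepModKer Ω p q r s) : p ≠ q := by
  rintro rfl
  have := h 1 1 0 0 (by simp [ZModModule.add_self])
  simp at this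

lemma pairwise_ne (h : IndepModKer Ω p q r s) :
    p ≠ q ∧ p ≠ r ∧ p ≠ s ∧ q ≠ r ∧ q ≠ s ∧ r ≠ s :=
  ⟨h.ne, h.swap.rotate.ne, h.rotate.rotate.rotate.ne.symm, h.rotate.ne,
    h.rotate.swap.rotate.ne, h.rotate.rotate.ne⟩

end IndepModKer

namespace IsD4Quad

variable {Ω : BForm V} {p q r s : V}

lemma rotate (hΩ : ∀ x, Ω x x = 0) (h : IsD4Quad Ω p q r s) : IsD4Quad Ω q r s p := by
  refine ⟨?_, h.indep.rotate⟩
  have := h.matrix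
  rw [form_comm hΩ q p, form_comm hΩ r p, form_comm hΩ s p]
  revert this
  generalize Ω p q = a, Ω p r = b, Ω p s = c, Ω q r = d, Ω q s = e, Ω r s = f
  revert a b c d e f; decide

end IsD4Quad

/-- A 5-cycle whose sum is not in the kernel of `Ω` forces a quadruple satisfying `IsD4Quad`. -/
lemma hasD4Quad_of_five_cycle {Ω : BForm V} (hΩ : ∀ x, Ω x x = 0) {B : Set V}
    (hspan : Submodule.span (ZMod 2) B = ⊤) {y₀ y₁ y₂ y₃ y₄ : V}
    (m₀ : y₀ ∈ B) (m₁ : y₁ ∈ B) (m₂ : y₂ ∈ B) (m₃ : y₃ ∈ B) (m₄ : y₄ ∈ B)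
    (h₀₁ : Ω y₀ y₁ = 1) (h₁₂ : Ω y₁ y₂ = 1) (h₂₃ : Ω y₂ y₃ = 1) (h₃₄ : Ω y₃ y₄ = 1)
    (h₀₄ : Ω y₀ y₄ = 1) (h₀₂ : Ω y₀ y₂ = 0) (h₀₃ : Ω y₀ y₃ = 0) (h₁₃ : Ω y₁ y₃ = 0)
    (h₁₄ : Ω y₁ y₄ = 0) (h₂₄ : Ω y₂ y₄ = 0)
    (hsum : Ω (y₀ + y₁ + y₂ + y₃ + y₄) ≠ 0) : HasD4Quad Ω B := by
  obtain ⟨v, mv, hv⟩ : ∃ v ∈ B, Ω (y₀ + y₁ + y₂ + y₃ + y₄) v ≠ 0 := by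
    by_contra! hcon
    exact hsum (LinearMap.ext_on hspan fun v hv => by simpa using hcon v hv)
  replace hv : Ω y₀ v + Ω y₁ v + Ω y₂ v + Ω y₃ v + Ω y₄ v = 1 := by
    rcases zmod_two_eq (Ω (y₀ + y₁ + y₂ + y₃ + y₄) v) with h | h
    · exact absurd h hv
    · simpa using h
  have indep : ∀ a b c d e f : ZMod 2,
      Ω (a • y₀ + b • y₁ + c • y₂ + d • y₃ + e • y₄ + f • v) = 0 →
      a = 0 ∧ b = 0 ∧ c = 0 ∧ d = 0 ∧ e = 0 ∧ f = 0 := by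
    intro a b c d e f hz
    have k := fun w => LinearMap.congr_fun hz w
    simp only [map_add, map_smul, LinearMap.add_apply, LinearMap.smul_apply, smul_eq_mul,
      LinearMap.zero_apply] at k
    have k₀ := k y₀
    have k₁ := k y₁
    have k₂ := k y₂
    have k₃ := k y₃
    have k₄ := k y₄
    have k₅ := k v
    rw [hΩ, form_comm hΩ y₁ y₀, form_comm hΩ y₂ y₀, form_comm hΩ y₃ y₀, form_comm hΩ y₄ y₀,
      form_comm hΩ v y₀, h₀₁, h₀₂, h₀₃, h₀₄] at k₀
    rw [hΩ, form_comm hΩ y₂ y₁, form_comm hΩ y₃ y₁, form_comm hΩ y₄ y₁,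
      form_comm hΩ v y₁, h₀₁, h₁₂, h₁₃, h₁₄] at k₁
    rw [hΩ, form_comm hΩ y₃ y₂, form_comm hΩ y₄ y₂,
      form_comm hΩ v y₂, h₀₂, h₁₂, h₂₃, h₂₄] at k₂
    rw [hΩ, form_comm hΩ y₄ y₃, form_comm hΩ v y₃, h₀₃, h₁₃, h₂₃, h₃₄] at k₃
    rw [hΩ, form_comm hΩ v y₄, h₀₄, h₁₄, h₂₄, h₃₄] at k₄
    rw [hΩ] at k₅
    have two : (2 : ZMod 2) = 0 := rfl
    have hf : f = 0 := by
      linear_combination k₀ + k₁ + k₂ + k₃ + k₄ - f * hv - (a + b + c + d + e) * two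
    subst hf
    have hbe : b = e := by linear_combination k₀ - e * two
    have hac : a = c := by linear_combination k₁ - c * two
    have had : a = d := by linear_combination k₄ - d * two
    have hce : c = e := by linear_combination k₃ - e * two
    subst hbe hac hce had
    have ha : a = 0 := by linear_combination k₅ - a * hv
    simp [ha]
  have key : IsD4Matrix (Ω y₀ y₁) (Ω y₀ y₂) (Ω y₀ v) (Ω y₁ y₂) (Ω y₁ v) (Ω y₂ v) ∨
      IsD4Matrix (Ω y₁ y₂) (Ω y₁ y₃) (Ω y₁ v) (Ω y₂ y₃) (Ω y₂ v) (Ω y₃ v) ∨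
      IsD4Matrix (Ω y₂ y₃) (Ω y₂ y₄) (Ω y₂ v) (Ω y₃ y₄) (Ω y₃ v) (Ω y₄ v) ∨
      IsD4Matrix (Ω y₀ y₃) (Ω y₀ y₄) (Ω y₀ v) (Ω y₃ y₄) (Ω y₃ v) (Ω y₄ v) ∨
      IsD4Matrix (Ω y₀ y₁) (Ω y₀ y₄) (Ω y₀ v) (Ω y₁ y₄) (Ω y₁ v) (Ω y₄ v) := by
    rw [h₀₁, h₁₂, h₂₃, h₃₄, h₀₄, h₀₂, h₀₃, h₁₃, h₁₄, h₂₄]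
    clear indep
    revert hv
    generalize Ω y₀ v = a, Ω y₁ v = b, Ω y₂ v = c, Ω y₃ v = d, Ω y₄ v = e
    revert a b c d e; decide
  rcases key with h | h | h | h | h
  · refine ⟨y₀, m₀, y₁, m₁, y₂, m₂, v, mv, h, fun a b c d hz => ?_⟩
    have := indep a b c 0 0 d (by simpa using hz)
    tauto
  · refine ⟨y₁, m₁, y₂, m₂, y₃, m₃, v, mv, h, fun a b c d hz => ?_⟩
    have := indep 0 a b c 0 d (by simpa using hz)
    tauto
  · refine ⟨y₂, m₂, y₃, m₃, y₄, m₄, v, mv, h, fun a b c d hz => ?_⟩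
    have := indep 0 0 a b c d (by simpa using hz)
    tauto
  · refine ⟨y₀, m₀, y₃, m₃, y₄, m₄, v, mv, h, fun a b c d hz => ?_⟩
    have := indep a 0 0 b c d (by simpa using hz)
    tauto
  · refine ⟨y₀, m₀, y₁, m₁, y₄, m₄, v, mv, h, fun a b c d hz => ?_⟩
    have := indep a b 0 0 c d (by simpa using hz)
    tauto

/-- The entries `l₁, l₂, l₃` of the row of a vector `a` with respect to a quadruple, in the case
`a = α p + β q + γ r + δ s` modulo the kernel: replacing `p` by `p + a` and leaving out one
vector involved in that relation gives a quadruple again. -/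
lemma isD4Matrix_of_dependent : ∀ e₀₁ e₀₂ e₀₃ e₁₂ e₁₃ e₂₃ α β γ δ : ZMod 2,
    IsD4Matrix e₀₁ e₀₂ e₀₃ e₁₂ e₁₃ e₂₃ → β * e₀₁ + γ * e₀₂ + δ * e₀₃ = 1 →
    ∀ l₁, l₁ = α * e₀₁ + γ * e₁₂ + δ * e₁₃ →
    ∀ l₂, l₂ = α * e₀₂ + β * e₁₂ + δ * e₂₃ →
    ∀ l₃, l₃ = α * e₀₃ + β * e₁₃ + γ * e₂₃ →
    (α = 0 ∧ IsD4Matrix (e₀₁ + l₁) (e₀₂ + l₂) (e₀₃ + l₃) e₁₂ e₁₃ e₂₃) ∨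
    (α = 1 ∧ IsD4Matrix e₁₂ e₁₃ l₁ e₂₃ l₂ l₃) ∨
    (β = 1 ∧ IsD4Matrix (e₀₂ + l₂) (e₀₃ + l₃) 1 e₂₃ l₂ l₃) ∨
    (γ = 1 ∧ IsD4Matrix (e₀₁ + l₁) (e₀₃ + l₃) 1 e₁₃ l₁ l₃) ∨
    (δ = 1 ∧ IsD4Matrix (e₀₁ + l₁) (e₀₂ + l₂) 1 e₁₂ l₁ l₂) := by
  decide +kernel

/-- The zero-diagonal `5 × 5` matrix with the given entries is that of the 5-cycle `0, …, 4`. -/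
def IsFiveCycle (e₀₁ e₀₂ e₀₃ e₀₄ e₁₂ e₁₃ e₁₄ e₂₃ e₂₄ e₃₄ : ZMod 2) : Prop :=
  (e₀₁ = 1 ∧ e₁₂ = 1 ∧ e₂₃ = 1 ∧ e₃₄ = 1 ∧ e₀₄ = 1) ∧
    e₀₂ = 0 ∧ e₀₃ = 0 ∧ e₁₃ = 0 ∧ e₁₄ = 0 ∧ e₂₄ = 0

instance (e₀₁ e₀₂ e₀₃ e₀₄ e₁₂ e₁₃ e₁₄ e₂₃ e₂₄ e₃₄ : ZMod 2) :
    Decidable (IsFiveCycle e₀₁ e₀₂ e₀₃ e₀₄ e₁₂ e₁₃ e₁₄ e₂₃ e₂₄ e₃₄) := by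
  unfold IsFiveCycle
  infer_instance

/-- In the independent case, replacing `p` by `p + a` either leaves a quadruple among the five
vectors or makes them a 5-cycle; `mᵢ` and `lᵢ` are the rows of `p + a` and `a`. -/
lemma isD4Matrix_or_isFiveCycle : ∀ m₁ m₂ m₃ e₁₂ e₁₃ e₂₃ l₁ l₂ l₃ : ZMod 2,
    IsD4Matrix (m₁ + l₁) (m₂ + l₂) (m₃ + l₃) e₁₂ e₁₃ e₂₃ →
    (IsD4Matrix m₁ m₂ m₃ e₁₂ e₁₃ e₂₃ ∨ IsD4Matrix e₁₂ e₁₃ l₁ e₂₃ l₂ l₃ ∨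
      IsD4Matrix m₂ m₃ 1 e₂₃ l₂ l₃ ∨ IsD4Matrix m₁ m₃ 1 e₁₃ l₁ l₃ ∨
      IsD4Matrix m₁ m₂ 1 e₁₂ l₁ l₂) ∨
    IsFiveCycle m₁ m₂ m₃ 1 e₁₂ e₁₃ l₁ e₂₃ l₂ l₃ ∨
    IsFiveCycle m₁ m₃ m₂ 1 e₁₃ e₁₂ l₁ e₂₃ l₃ l₂ ∨
    IsFiveCycle m₂ m₁ m₃ 1 e₁₂ e₂₃ l₂ e₁₃ l₁ l₃ ∨
    IsFiveCycle m₂ m₃ m₁ 1 e₂₃ e₁₂ l₂ e₁₃ l₃ l₁ ∨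
    IsFiveCycle m₃ m₁ m₂ 1 e₁₃ e₂₃ l₃ e₁₂ l₁ l₂ ∨
    IsFiveCycle m₃ m₂ m₁ 1 e₂₃ e₁₃ l₃ e₁₂ l₂ l₁ := by
  decide +kernel

/-- If `p, q, r, s` satisfy `IsD4Quad` and `Ω(p, a) = 1`, then a spanning set containing
`p + a, q, r, s, a` contains a quadruple satisfying `IsD4Quad`. -/
lemma hasD4Quad_of_add {Ω : BForm V} (hΩ : ∀ x, Ω x x = 0) {B : Set V}
    (hspan : Submodule.span (ZMod 2) B = ⊤) {p q r s a : V} (h : IsD4Quad Ω p q r s)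
    (hpa : Ω p a = 1) (mp : p + a ∈ B) (mq : q ∈ B) (mr : r ∈ B) (ms : s ∈ B) (ma : a ∈ B) :
    HasD4Quad Ω B := by
  have two : (2 : ZMod 2) = 0 := rfl
  have hM := h.matrix
  have c₁ : Ω (p + a) q = Ω p q + Ω q a := by simp [form_comm hΩ a q]
  have c₂ : Ω (p + a) r = Ω p r + Ω r a := by simp [form_comm hΩ a r]
  have c₃ : Ω (p + a) s = Ω p s + Ω s a := by simp [form_comm hΩ a s]
  have c₄ : Ω (p + a) a = 1 := by simp [hΩ, hpa]
  have expand : ∀ α β γ δ ε : ZMod 2, Ω (α • (p + a) + β • q + γ • r + δ • s + ε • a) = 0 →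
      Ω (α • p + β • q + γ • r + δ • s + (α + ε) • a) = 0 := by
    intro α β γ δ ε hz
    rw [← hz]
    congr 1
    module
  by_cases hdep : ∃ α β γ δ : ZMod 2, Ω (α • p + β • q + γ • r + δ • s + a) = 0
  · obtain ⟨α, β, γ, δ, hz⟩ := hdep
    have row : ∀ w, Ω w a = α * Ω p w + β * Ω q w + γ * Ω r w + δ * Ω s w := by
      intro w
      have := LinearMap.congr_fun hz w
      simp only [map_add, map_smul, LinearMap.add_apply, LinearMap.smul_apply, smul_eq_mul,
        LinearMap.zero_apply] at this
      rw [form_comm hΩ w a]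
      linear_combination -this + Ω a w * two
    have hp := row p
    have hq := row q
    have hr := row r
    have hs := row s
    rw [hpa, hΩ, form_comm hΩ q p, form_comm hΩ r p, form_comm hΩ s p] at hp
    rw [hΩ, form_comm hΩ r q, form_comm hΩ s q] at hq
    rw [hΩ, form_comm hΩ s r] at hr
    rw [hΩ] at hs
    have indep : ∀ α' β' γ' δ' ε' : ZMod 2,
        Ω (α' • (p + a) + β' • q + γ' • r + δ' • s + ε' • a) = 0 →
        ∃ t, α' = t * α ∧ β' = t * β ∧ γ' = t * γ ∧ δ' = t * δ ∧ ε' = t * (1 + α) := by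
      intro α' β' γ' δ' ε' hz'
      obtain ⟨h₀, h₁, h₂, h₃⟩ := h.indep (α' - (α' + ε') * α) (β' - (α' + ε') * β)
        (γ' - (α' + ε') * γ) (δ' - (α' + ε') * δ) (by
          have e := congrArg₂ (fun f g => f - (α' + ε') • g) (expand _ _ _ _ _ hz') hz
          simp only [smul_zero, sub_zero] at e
          rw [← e, ← map_smul, ← map_sub]
          congr 1
          module)
      rw [sub_eq_zero] at h₀ h₁ h₂ h₃
      exact ⟨α' + ε', h₀, h₁, h₂, h₃, by linear_combination h₀ - α' * two⟩
    rcases isD4Matrix_of_dependent _ _ _ _ _ _ α β γ δ hM (by linear_combination -hp) (Ω q a)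
      (by linear_combination hq) (Ω r a) (by linear_combination hr) (Ω s a)
      (by linear_combination hs) with ⟨h1, h2⟩ | ⟨h1, h2⟩ | ⟨h1, h2⟩ | ⟨h1, h2⟩ | ⟨h1, h2⟩
    · refine ⟨_, mp, q, mq, r, mr, s, ms, by rwa [c₁, c₂, c₃], fun α' β' γ' δ' hz' => ?_⟩
      obtain ⟨t, k₀, k₁, k₂, k₃, k₄⟩ := indep α' β' γ' δ' 0 (by simpa using hz')
      obtain rfl : t = 0 := by linear_combination -k₄ - t * h1
      rw [zero_mul] at k₀ k₁ k₂ k₃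
      exact ⟨k₀, k₁, k₂, k₃⟩
    · refine ⟨q, mq, r, mr, s, ms, a, ma, h2, fun β' γ' δ' ε' hz' => ?_⟩
      obtain ⟨t, k₀, k₁, k₂, k₃, k₄⟩ := indep 0 β' γ' δ' ε' (by simpa using hz')
      obtain rfl : t = 0 := by linear_combination -k₀ - t * h1
      rw [zero_mul] at k₁ k₂ k₃ k₄
      exact ⟨k₁, k₂, k₃, k₄⟩
    · refine ⟨_, mp, r, mr, s, ms, a, ma, by rwa [c₂, c₃, c₄], fun α' γ' δ' ε' hz' => ?_⟩
      obtain ⟨t, k₀, k₁, k₂, k₃, k₄⟩ := indep α' 0 γ' δ' ε' (by simpa using hz')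
      obtain rfl : t = 0 := by linear_combination -k₁ - t * h1
      rw [zero_mul] at k₀ k₂ k₃ k₄
      exact ⟨k₀, k₂, k₃, k₄⟩
    · refine ⟨_, mp, q, mq, s, ms, a, ma, by rwa [c₁, c₃, c₄], fun α' β' δ' ε' hz' => ?_⟩
      obtain ⟨t, k₀, k₁, k₂, k₃, k₄⟩ := indep α' β' 0 δ' ε' (by simpa using hz')
      obtain rfl : t = 0 := by linear_combination -k₂ - t * h1
      rw [zero_mul] at k₀ k₁ k₃ k₄
      exact ⟨k₀, k₁, k₃, k₄⟩
    · refine ⟨_, mp, q, mq, r, mr, a, ma, by rwa [c₁, c₂, c₄], fun α' β' γ' ε' hz' => ?_⟩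
      obtain ⟨t, k₀, k₁, k₂, k₃, k₄⟩ := indep α' β' γ' 0 ε' (by simpa using hz')
      obtain rfl : t = 0 := by linear_combination -k₃ - t * h1
      rw [zero_mul] at k₀ k₁ k₂ k₄
      exact ⟨k₀, k₁, k₂, k₄⟩
  · have indep : ∀ α β γ δ ε : ZMod 2, Ω (α • (p + a) + β • q + γ • r + δ • s + ε • a) = 0 →
        α = 0 ∧ β = 0 ∧ γ = 0 ∧ δ = 0 ∧ ε = 0 := by
      intro α β γ δ ε hz
      have hz' := expand _ _ _ _ _ hz
      rcases zmod_two_eq (α + ε) with h0 | h1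
      · rw [h0, zero_smul, add_zero] at hz'
        obtain ⟨rfl, rfl, rfl, rfl⟩ := h.indep _ _ _ _ hz'
        simpa using h0
      · rw [h1, one_smul] at hz'
        exact absurd ⟨α, β, γ, δ, hz'⟩ hdep
    have hsum : Ω (p + a + q + r + s + a) ≠ 0 := by
      intro hz
      have := indep 1 1 1 1 1 (by simpa using hz)
      simp at this
    have cancel : ∀ x y : ZMod 2, x + y + y = x := by decide
    have comm := form_comm hΩ
    rcases isD4Matrix_or_isFiveCycle (Ω (p + a) q) (Ω (p + a) r) (Ω (p + a) s) (Ω q r) (Ω q s)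
      (Ω r s) (Ω q a) (Ω r a) (Ω s a) (by rwa [c₁, c₂, c₃, cancel, cancel, cancel]) with
      (h1 | h1 | h1 | h1 | h1) | h1 | h1 | h1 | h1 | h1 | h1
    · refine ⟨_, mp, q, mq, r, mr, s, ms, h1, fun α' β' γ' δ' hz' => ?_⟩
      have := indep α' β' γ' δ' 0 (by simpa using hz')
      tauto
    · refine ⟨q, mq, r, mr, s, ms, a, ma, h1, fun β' γ' δ' ε' hz' => ?_⟩
      have := indep 0 β' γ' δ' ε' (by simpa using hz')
      tauto
    · refine ⟨_, mp, r, mr, s, ms, a, ma, by rwa [c₄], fun α' γ' δ' ε' hz' => ?_⟩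
      have := indep α' 0 γ' δ' ε' (by simpa using hz')
      tauto
    · refine ⟨_, mp, q, mq, s, ms, a, ma, by rwa [c₄], fun α' β' δ' ε' hz' => ?_⟩
      have := indep α' β' 0 δ' ε' (by simpa using hz')
      tauto
    · refine ⟨_, mp, q, mq, r, mr, a, ma, by rwa [c₄], fun α' β' γ' ε' hz' => ?_⟩
      have := indep α' β' γ' 0 ε' (by simpa using hz')
      tauto
    · obtain ⟨⟨h₁, h₂, h₃, h₄, -⟩, h₅, h₆, h₇, h₈, h₉⟩ := h1
      exact hasD4Quad_of_five_cycle hΩ hspan mp mq mr ms ma h₁ h₂ h₃ h₄ c₄ h₅ h₆ h₇ h₈ h₉ hsum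
    · obtain ⟨⟨h₁, h₂, h₃, h₄, -⟩, h₅, h₆, h₇, h₈, h₉⟩ := h1
      refine hasD4Quad_of_five_cycle hΩ hspan mp mq ms mr ma h₁ h₂ (comm _ _ ▸ h₃) h₄ c₄ h₅ h₆ h₇
        h₈ h₉ ?_
      convert hsum using 2; abel
    · obtain ⟨⟨h₁, h₂, h₃, h₄, -⟩, h₅, h₆, h₇, h₈, h₉⟩ := h1
      refine hasD4Quad_of_five_cycle hΩ hspan mp mr mq ms ma h₁ (comm _ _ ▸ h₂) h₃ h₄ c₄ h₅ h₆ h₇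
        h₈ h₉ ?_
      convert hsum using 2; abel
    · obtain ⟨⟨h₁, h₂, h₃, h₄, -⟩, h₅, h₆, h₇, h₈, h₉⟩ := h1
      refine hasD4Quad_of_five_cycle hΩ hspan mp mr ms mq ma h₁ h₂ (comm _ _ ▸ h₃) h₄ c₄ h₅ h₆
        (comm _ _ ▸ h₇) h₈ h₉ ?_
      convert hsum using 2; abel
    · obtain ⟨⟨h₁, h₂, h₃, h₄, -⟩, h₅, h₆, h₇, h₈, h₉⟩ := h1
      refine hasD4Quad_of_five_cycle hΩ hspan mp ms mq mr ma h₁ (comm _ _ ▸ h₂) h₃ h₄ c₄ h₅ h₆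
        (comm _ _ ▸ h₇) h₈ h₉ ?_
      convert hsum using 2; abel
    · obtain ⟨⟨h₁, h₂, h₃, h₄, -⟩, h₅, h₆, h₇, h₈, h₉⟩ := h1
      refine hasD4Quad_of_five_cycle hΩ hspan mp ms mr mq ma h₁ (comm _ _ ▸ h₂) (comm _ _ ▸ h₃) h₄
        c₄ h₅ h₆ (comm _ _ ▸ h₇) h₈ h₉ ?_
      convert hsum using 2; abel

lemma MoveRel.span_eq_top {Ω : BForm V} {B B' : Set V} (h : MoveRel Ω B B')
    (hspan : Submodule.span (ZMod 2) B = ⊤) : Submodule.span (ZMod 2) B' = ⊤ := by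
  obtain ⟨a, c, ha, hc, hac, -, rfl⟩ := h
  rw [eq_top_iff, ← hspan, Submodule.span_le]
  have ma : a ∈ Submodule.span (ZMod 2) (insert (c + a) (B \ {c})) :=
    Submodule.subset_span (Or.inr ⟨ha, hac⟩)
  intro b hb
  by_cases hbc : b = c
  · have := sub_mem (Submodule.subset_span (Set.mem_insert (c + a) (B \ {c}))) ma
    rw [add_sub_cancel_right] at this
    rwa [hbc]
  · exact Submodule.subset_span (Or.inr ⟨hb, hbc⟩)

lemma MoveRel.hasD4Quad {Ω : BForm V} (hΩ : ∀ x, Ω x x = 0) {B B' : Set V} (h : MoveRel Ω B B')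
    (hspan : Submodule.span (ZMod 2) B = ⊤) (hB' : HasD4Quad Ω B') : HasD4Quad Ω B := by
  obtain ⟨a, c, ha, hc, hac, hΩac, rfl⟩ := h
  have mem : ∀ x ∈ insert (c + a) (B \ {c}), c + a ≠ x → x ∈ B := by
    rintro x (rfl | hx) hne
    · exact absurd rfl hne
    · exact hx.1
  have first : ∀ q ∈ insert (c + a) (B \ {c}), ∀ r ∈ insert (c + a) (B \ {c}),
      ∀ s ∈ insert (c + a) (B \ {c}), IsD4Quad Ω (c + a) q r s → HasD4Quad Ω B := by
    intro q hq r hr s hs hD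
    obtain ⟨hpq, hpr, hps, -⟩ := hD.indep.pairwise_ne
    refine hasD4Quad_of_add hΩ hspan hD (a := a) ?_ ?_ (mem q hq hpq) (mem r hr hpr)
      (mem s hs hps) ha
    · simp [hΩ, form_comm hΩ c a, hΩac]
    · rwa [add_assoc, ZModModule.add_self, add_zero]
  obtain ⟨p, hp, q, hq, r, hr, s, hs, hD⟩ := hB'
  by_cases h1 : c + a = p
  · subst h1; exact first q hq r hr s hs hD
  by_cases h2 : c + a = q
  · subst h2; exact first r hr s hs p hp (hD.rotate hΩ)
  by_cases h3 : c + a = r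
  · subst h3; exact first s hs p hp q hq ((hD.rotate hΩ).rotate hΩ)
  by_cases h4 : c + a = s
  · subst h4; exact first p hp q hq r hr (((hD.rotate hΩ).rotate hΩ).rotate hΩ)
  exact ⟨p, mem p hp h1, q, mem q hq h2, r, mem r hr h3, s, mem s hs h4, hD⟩

lemma EquivSets.hasD4Quad {Ω : BForm V} (hΩ : ∀ x, Ω x x = 0) {B B' : Set V}
    (h : EquivSets Ω B B') (hB' : HasD4Quad Ω B') (hspan : Submodule.span (ZMod 2) B = ⊤) :
    HasD4Quad Ω B := by
  induction h using Relation.ReflTransGen.head_induction_on with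
  | refl => exact hB'
  | head hmove _ ih => exact hmove.hasD4Quad hΩ hspan (ih (hmove.span_eq_top hspan))

lemma Gr_adj_iff {Ω : BForm V} (hΩ : ∀ x, Ω x x = 0) {X : Set V} (x y : X) :
    (Gr Ω X).Adj x y ↔ Ω x.1 y.1 = 1 := by
  rw [Gr, SimpleGraph.fromRel_adj, form_comm hΩ y.1 x.1, or_self, and_iff_right_iff_imp]
  rintro h rfl
  simp [hΩ] at h

lemma hasD4Quad_of_E6 {Ω : BForm V} (hΩ : ∀ x, Ω x x = 0) {X : Set V}
    (e : Gr Ω X ≃g E6Graph) : HasD4Quad Ω X := by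
  obtain ⟨y, hy, hadj⟩ : ∃ y : Fin 6 → V, (∀ i, y i ∈ X) ∧
      ∀ i j, E6Graph.Adj i j ↔ Ω (y i) (y j) = 1 :=
    ⟨fun i => (e.symm i).1, fun i => (e.symm i).2, fun i j => by
      rw [← Gr_adj_iff hΩ, e.symm.map_adj_iff]⟩
  have one : ∀ i j, E6Graph.Adj i j → Ω (y i) (y j) = 1 := fun i j => (hadj i j).1
  have zero : ∀ i j, ¬E6Graph.Adj i j → Ω (y i) (y j) = 0 := fun i j h =>
    (zmod_two_eq _).resolve_right fun h' => h ((hadj i j).2 h')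
  have h₂₁ := one 2 1 (by simp [E6Graph])
  have h₂₃ := one 2 3 (by simp [E6Graph])
  have h₂₅ := one 2 5 (by simp [E6Graph])
  have h₁₀ := one 1 0 (by simp [E6Graph])
  have h₃₄ := one 3 4 (by simp [E6Graph])
  have h₅₂ := one 5 2 (by simp [E6Graph])
  have h₁₃ := zero 1 3 (by simp [E6Graph])
  have h₁₅ := zero 1 5 (by simp [E6Graph])
  have h₃₅ := zero 3 5 (by simp [E6Graph])
  have h₂₀ := zero 2 0 (by simp [E6Graph])
  have h₃₀ := zero 3 0 (by simp [E6Graph])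
  have h₅₀ := zero 5 0 (by simp [E6Graph])
  have h₂₄ := zero 2 4 (by simp [E6Graph])
  have h₁₄ := zero 1 4 (by simp [E6Graph])
  have h₅₄ := zero 5 4 (by simp [E6Graph])
  refine ⟨y 2, hy 2, y 1, hy 1, y 3, hy 3, y 5, hy 5, ?_, fun α β γ δ hz => ?_⟩
  · rw [h₂₁, h₂₃, h₂₅, h₁₃, h₁₅, h₃₅]
    decide
  · have k := fun w => LinearMap.congr_fun hz w
    simp only [map_add, map_smul, LinearMap.add_apply, LinearMap.smul_apply, smul_eq_mul,
      LinearMap.zero_apply] at k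
    obtain rfl : β = 0 := by simpa [h₂₀, h₁₀, h₃₀, h₅₀] using k (y 0)
    obtain rfl : γ = 0 := by simpa [h₂₄, h₁₄, h₃₄, h₅₄] using k (y 4)
    obtain rfl : δ = 0 := by simpa [hΩ, h₅₂] using k (y 2)
    obtain rfl : α = 0 := by simpa [h₂₁] using k (y 1)
    simp

/-- Vectors indexed by the vertices of `H` with the adjacency of `H` have graph `H`. -/
lemma nonempty_Gr_range_iso {Ω : BForm V} (hΩ : ∀ x, Ω x x = 0) {α : Type*} (H : SimpleGraph α)
    (f : α → V) (hf : Function.Injective f) (hadj : ∀ i j, H.Adj i j ↔ Ω (f i) (f j) = 1) :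
    Nonempty (Gr Ω (Set.range f) ≃g H) :=
  ⟨(⟨Equiv.ofInjective f hf, fun {i j} => by
    rw [Gr_adj_iff hΩ, hadj]; rfl⟩ : H ≃g Gr Ω (Set.range f)).symm⟩

lemma exists_inF_of_family {Ω : BForm V} (hΩ : ∀ x, Ω x x = 0) {B : Set V} (hne : B.Nonempty)
    {α : Type*} [Fintype α] (H : SimpleGraph α)
    (hH : ∀ X : Set V, Nonempty (Gr Ω X ≃g H) → InF (Gr Ω X)) (f : α → V) (hfB : ∀ i, f i ∈ B)
    (hf : LinearIndependent (ZMod 2) fun i => Ω (f i))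
    (hadj : ∀ i j, H.Adj i j ↔ Ω (f i) (f j) = 1) :
    ∃ X ⊆ B, InF (Gr Ω X) ∧ (Submodule.span (ZMod 2) X : Set V) ∩ V000set Ω B = {0} := by
  have hinj : Function.Injective f := fun i j hij => hf.injective (congrArg Ω hij)
  refine ⟨Set.range f, Set.range_subset_iff.2 hfB,
    hH _ (nonempty_Gr_range_iso hΩ H f hinj hadj), ?_⟩
  refine Set.Subset.antisymm ?_ ?_
  · rintro x ⟨hx, hx0, -⟩
    obtain ⟨c, rfl⟩ := (Submodule.mem_span_range_iff_exists_fun _).1 hx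
    have hc := Fintype.linearIndependent_iff.1 hf c (by
      ext v
      simpa using hx0 v)
    simp [hc]
  · obtain ⟨b, hb⟩ := hne
    have hbΔ : b ∈ Delta Ω B := ⟨b, hb, 1, one_mem _, rfl⟩
    rintro _ rfl
    exact ⟨zero_mem _, fun v => by simp, b, hbΔ, b, hbΔ, (ZModModule.add_self b).symm⟩

section Patterns

variable {Ω : BForm V} {B : Set V} {p q r s : V}

lemma IndepModKer.linearIndependent (h : IndepModKer Ω p q r s) :
    LinearIndependent (ZMod 2) fun i => Ω (![p, q, r, s] i) := by
  rw [Fintype.linearIndependent_iff]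
  intro c hc
  have := h (c 0) (c 1) (c 2) (c 3) (by simpa [Fin.sum_univ_four] using hc)
  intro i
  fin_cases i <;> simp [this]

lemma exists_inF_of_claw (hΩ : ∀ x, Ω x x = 0)
    (mp : p ∈ B) (mq : q ∈ B) (mr : r ∈ B) (ms : s ∈ B) (h : IndepModKer Ω p q r s)
    (hpq : Ω p q = 1) (hpr : Ω p r = 1) (hps : Ω p s = 1) (hqr : Ω q r = 0) (hqs : Ω q s = 0)
    (hrs : Ω r s = 0) :
    ∃ X ⊆ B, InF (Gr Ω X) ∧ (Submodule.span (ZMod 2) X : Set V) ∩ V000set Ω B = {0} := by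
  refine exists_inF_of_family hΩ ⟨p, mp⟩ (DmkGraph 2 2) (fun _ hX => Or.inl hX)
    (Sum.elim ![q, p] ![r, s]) ?_ ?_ ?_
  · rintro (i | i) <;> fin_cases i <;> simpa
  · rw [Fintype.linearIndependent_iff]
    intro c hc
    have := h (c (Sum.inl 1)) (c (Sum.inl 0)) (c (Sum.inr 0)) (c (Sum.inr 1)) (by
      simp only [Fintype.sum_sum_type, Fin.sum_univ_two] at hc
      simp only [map_add, map_smul]
      rw [← hc]
      simp only [Sum.elim_inl, Sum.elim_inr, Matrix.cons_val_zero, Matrix.cons_val_one]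
      abel)
    rintro (i | i) <;> fin_cases i <;> simp [this]
  · have := form_comm hΩ
    rintro (i | i) (j | j) <;> fin_cases i <;> fin_cases j <;>
      simp [DmkGraph, hΩ, hpq, hpr, hps, hqr, hqs, hrs, this q p, this r p, this s p, this r q,
        this s q, this s r]

lemma exists_inF_of_two_triangles (hΩ : ∀ x, Ω x x = 0)
    (mp : p ∈ B) (mq : q ∈ B) (mr : r ∈ B) (ms : s ∈ B) (h : IndepModKer Ω p q r s)
    (hpq : Ω p q = 1) (hpr : Ω p r = 1) (hps : Ω p s = 1) (hqr : Ω q r = 1) (hqs : Ω q s = 1)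
    (hrs : Ω r s = 0) :
    ∃ X ⊆ B, InF (Gr Ω X) ∧ (Submodule.span (ZMod 2) X : Set V) ∩ V000set Ω B = {0} := by
  refine exists_inF_of_family hΩ ⟨p, mp⟩ TwoTrianglesGraph (fun _ hX => Or.inr (Or.inl hX))
    ![p, q, r, s] (fun i => by fin_cases i <;> simpa) h.linearIndependent ?_
  have := form_comm hΩ
  intro i j
  fin_cases i <;> fin_cases j <;>
    simp [TwoTrianglesGraph, hΩ, hpq, hpr, hps, hqr, hqs, hrs, this q p, this r p, this s p,
      this r q, this s q, this s r]

lemma exists_inF_of_four_cycle (hΩ : ∀ x, Ω x x = 0)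
    (mp : p ∈ B) (mq : q ∈ B) (mr : r ∈ B) (ms : s ∈ B) (h : IndepModKer Ω p q r s)
    (hpq : Ω p q = 1) (hpr : Ω p r = 0) (hps : Ω p s = 1) (hqr : Ω q r = 1) (hqs : Ω q s = 0)
    (hrs : Ω r s = 1) :
    ∃ X ⊆ B, InF (Gr Ω X) ∧ (Submodule.span (ZMod 2) X : Set V) ∩ V000set Ω B = {0} := by
  refine exists_inF_of_family hΩ ⟨p, mp⟩ (CycleGraph 4)
    (fun _ hX => Or.inr (Or.inr ⟨4, le_rfl, hX⟩))
    ![p, q, r, s] (fun i => by fin_cases i <;> simpa) h.linearIndependent ?_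
  have := form_comm hΩ
  intro i j
  fin_cases i <;> fin_cases j <;>
    simp [CycleGraph, hΩ, hpq, hpr, hps, hqr, hqs, hrs, this q p, this r p, this s p,
      this r q, this s q, this s r]

end Patterns

set_option synthInstance.maxSize 1000 in
/-- The adjacency matrices of the claws, the pairs of triangles sharing an edge, and the
4-cycles on four vertices. -/
lemma IsD4Matrix.cases : ∀ {e₀₁ e₀₂ e₀₃ e₁₂ e₁₃ e₂₃ : ZMod 2},
    IsD4Matrix e₀₁ e₀₂ e₀₃ e₁₂ e₁₃ e₂₃ →
    (e₀₁ = 1 ∧ e₀₂ = 1 ∧ e₀₃ = 1 ∧ e₁₂ = 0 ∧ e₁₃ = 0 ∧ e₂₃ = 0) ∨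
    (e₀₁ = 1 ∧ e₀₂ = 0 ∧ e₀₃ = 0 ∧ e₁₂ = 1 ∧ e₁₃ = 1 ∧ e₂₃ = 0) ∨
    (e₀₁ = 0 ∧ e₀₂ = 1 ∧ e₀₃ = 0 ∧ e₁₂ = 1 ∧ e₁₃ = 0 ∧ e₂₃ = 1) ∨
    (e₀₁ = 0 ∧ e₀₂ = 0 ∧ e₀₃ = 1 ∧ e₁₂ = 0 ∧ e₁₃ = 1 ∧ e₂₃ = 1) ∨
    (e₀₁ = 1 ∧ e₀₂ = 1 ∧ e₀₃ = 1 ∧ e₁₂ = 1 ∧ e₁₃ = 1 ∧ e₂₃ = 0) ∨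
    (e₀₁ = 1 ∧ e₀₂ = 1 ∧ e₀₃ = 1 ∧ e₁₂ = 1 ∧ e₁₃ = 0 ∧ e₂₃ = 1) ∨
    (e₀₁ = 1 ∧ e₀₂ = 1 ∧ e₀₃ = 1 ∧ e₁₂ = 0 ∧ e₁₃ = 1 ∧ e₂₃ = 1) ∨
    (e₀₁ = 1 ∧ e₀₂ = 1 ∧ e₀₃ = 0 ∧ e₁₂ = 1 ∧ e₁₃ = 1 ∧ e₂₃ = 1) ∨
    (e₀₁ = 1 ∧ e₀₂ = 0 ∧ e₀₃ = 1 ∧ e₁₂ = 1 ∧ e₁₃ = 1 ∧ e₂₃ = 1) ∨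
    (e₀₁ = 0 ∧ e₀₂ = 1 ∧ e₀₃ = 1 ∧ e₁₂ = 1 ∧ e₁₃ = 1 ∧ e₂₃ = 1) ∨
    (e₀₁ = 1 ∧ e₀₂ = 0 ∧ e₀₃ = 1 ∧ e₁₂ = 1 ∧ e₁₃ = 0 ∧ e₂₃ = 1) ∨
    (e₀₁ = 0 ∧ e₀₂ = 1 ∧ e₀₃ = 1 ∧ e₁₂ = 1 ∧ e₁₃ = 1 ∧ e₂₃ = 0) ∨
    (e₀₁ = 1 ∧ e₀₂ = 1 ∧ e₀₃ = 0 ∧ e₁₂ = 0 ∧ e₁₃ = 1 ∧ e₂₃ = 1) := by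
  decide +kernel

lemma HasD4Quad.exists_inF {Ω : BForm V} (hΩ : ∀ x, Ω x x = 0) {B : Set V} (h : HasD4Quad Ω B) :
    ∃ X ⊆ B, InF (Gr Ω X) ∧ (Submodule.span (ZMod 2) X : Set V) ∩ V000set Ω B = {0} := by
  obtain ⟨p, mp, q, mq, r, mr, s, ms, h⟩ := h
  rcases h.matrix.cases with h' | h' | h' | h' | h' | h' | h' | h' | h' | h' | h' | h' | h' <;>
    obtain ⟨h₁, h₂, h₃, h₄, h₅, h₆⟩ := h'
  · refine exists_inF_of_claw hΩ mp mq mr ms h.indep ?_ ?_ ?_ ?_ ?_ ?_ <;> assumption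
  · refine exists_inF_of_claw hΩ mq mp mr ms h.indep.swap
      ?_ ?_ ?_ ?_ ?_ ?_ <;> first | assumption | (rw [form_comm hΩ]; assumption)
  · refine exists_inF_of_claw hΩ mr ms mp mq h.indep.rotate.rotate
      ?_ ?_ ?_ ?_ ?_ ?_ <;> first | assumption | (rw [form_comm hΩ]; assumption)
  · refine exists_inF_of_claw hΩ ms mp mq mr h.indep.rotate.rotate.rotate
      ?_ ?_ ?_ ?_ ?_ ?_ <;> first | assumption | (rw [form_comm hΩ]; assumption)
  · refine exists_inF_of_two_triangles hΩ mp mq mr ms h.indep ?_ ?_ ?_ ?_ ?_ ?_ <;> assumption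
  · refine exists_inF_of_two_triangles hΩ mp mr ms mq h.indep.swap.rotate
      ?_ ?_ ?_ ?_ ?_ ?_ <;> first | assumption | (rw [form_comm hΩ]; assumption)
  · refine exists_inF_of_two_triangles hΩ ms mp mq mr h.indep.rotate.rotate.rotate
      ?_ ?_ ?_ ?_ ?_ ?_ <;> first | assumption | (rw [form_comm hΩ]; assumption)
  · refine exists_inF_of_two_triangles hΩ mq mr ms mp h.indep.rotate
      ?_ ?_ ?_ ?_ ?_ ?_ <;> first | assumption | (rw [form_comm hΩ]; assumption)
  · refine exists_inF_of_two_triangles hΩ mq ms mp mr h.indep.rotate.swap.rotate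
      ?_ ?_ ?_ ?_ ?_ ?_ <;> first | assumption | (rw [form_comm hΩ]; assumption)
  · refine exists_inF_of_two_triangles hΩ mr ms mp mq h.indep.rotate.rotate
      ?_ ?_ ?_ ?_ ?_ ?_ <;> first | assumption | (rw [form_comm hΩ]; assumption)
  · refine exists_inF_of_four_cycle hΩ mp mq mr ms h.indep ?_ ?_ ?_ ?_ ?_ ?_ <;> assumption
  · refine exists_inF_of_four_cycle hΩ mr mq ms mp h.indep.rotate.swap
      ?_ ?_ ?_ ?_ ?_ ?_ <;> first | assumption | (rw [form_comm hΩ]; assumption)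
  · refine exists_inF_of_four_cycle hΩ mp mr ms mq h.indep.swap.rotate
      ?_ ?_ ?_ ?_ ?_ ?_ <;> first | assumption | (rw [form_comm hΩ]; assumption)

/-- If the basis `B` (with `Gr(B)` connected) is equivalent to a basis whose
graph is a tree containing `E₆` as an induced subgraph, then some `X ⊆ B` induces a
subgraph of `Gr(B)` isomorphic to a member of `F` with `span(X) ∩ V₀₀₀ = {0}`. -/
theorem stmt_7 {V : Type*} [AddCommGroup V] [Module (ZMod 2) V]
    [FiniteDimensional (ZMod 2) V]
    (Ω : BForm V) (hΩ : ∀ x : V, Ω x x = 0)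
    (B : Set V) (hB : IsBasisSet B) (hconn : (Gr Ω B).Connected)
    (hE6 : EquivToE6Tree Ω B) :
    ∃ X ⊆ B, InF (Gr Ω X) ∧
      (Submodule.span (ZMod 2) X : Set V) ∩ V000set Ω B = {0} := by
  obtain ⟨B', hequiv, -, X, hX, ⟨e⟩⟩ := hE6
  obtain ⟨p, hp, q, hq, r, hr, s, hs, h⟩ := hasD4Quad_of_E6 hΩ e
  exact (EquivSets.hasD4Quad hΩ hequiv ⟨p, hX hp, q, hX hq, r, hX hr, s, hX hs, h⟩
    hB.2).exists_inF hΩ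
end
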